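/- arXiv:1507.02651 — 7 statements merged into one kernel-verified Lean document; each statement's English description precedes it below -/
import Mathlib

section
/- Let (Ω, 𝔉, (𝔉_r)_{r ∈ [0,∞]}, P) be a filtered probability space (with terminal index ∞ included), μ a Borel probability measure on [0,∞) with ∫ x μ(dx) < ∞, and (ξ_r)_{r ∈ [0,∞]} an adapted process of Borel probability measures on [0,∞) with finite first moment such that: for every Borel set A ⊆ [0,∞), the process (ξ_r(A))_{r ∈ [0,∞]} is a martingale (including the index ∞); ξ_0 = μ almost surely; and ξ_∞ = δ_Y almost surely for some random variable Y : Ω → [0,∞). Then X_r := ∫ x ξ_r(dx), for r ∈ [0,∞], defines a nonnegative, uniformly integrable martingale with X_∞ = Y almost surely, X_r = E[Y | 𝔉_r] almost surely for every r, and the law of Y under P equals μ. -/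
open MeasureTheory Filter
open scoped NNReal ENNReal

/-- A random probability measure whose evaluations on measurable sets have measurable real values
is measurable for the Giry σ-algebra. -/
lemma measurable_measure_of_measurable_toReal {Ω α : Type*} {m : MeasurableSpace Ω}
    [MeasurableSpace α] {κ : Ω → Measure α} (hprob : ∀ ω, IsProbabilityMeasure (κ ω))
    (hκ : ∀ A, MeasurableSet A → Measurable fun ω => (κ ω A).toReal) : Measurable κ := by
  refine Measure.measurable_of_measurable_coe _ fun A hA => ?_
  simpa using (hκ A hA).ennreal_ofReal

/-- If the evaluations of `κ` are the conditional probabilities of `{Y ∈ A}`, in the sense that they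
have the same integrals over `S`, then averaging `κ` over `S` gives the law of `Y` on `S`. -/
lemma restrict_bind_eq_map {Ω α : Type*} {mΩ : MeasurableSpace Ω} [MeasurableSpace α]
    {P : Measure Ω} [IsFiniteMeasure P] {κ : Ω → Measure α}
    (hprob : ∀ ω, IsProbabilityMeasure (κ ω)) (hκ : Measurable κ) {Y : Ω → α} (hY : Measurable Y)
    {S : Set Ω}
    (h : ∀ A, MeasurableSet A →
      ∫ ω in S, (κ ω A).toReal ∂P = ∫ ω in S, (Measure.dirac (Y ω) A).toReal ∂P) :
    (P.restrict S).bind κ = (P.restrict S).map Y := by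
  ext A hA
  rw [Measure.bind_apply hA hκ.aemeasurable, ← Measure.bind_dirac_eq_map _ hY,
    Measure.bind_apply (f := fun ω => Measure.dirac (Y ω)) hA
      (Measure.measurable_dirac.comp hY).aemeasurable]
  have hκA : Measurable fun ω => κ ω A := (Measure.measurable_coe hA).comp hκ
  have hYA : Measurable fun ω => Measure.dirac (Y ω) A :=
    (Measure.measurable_coe hA).comp (Measure.measurable_dirac.comp hY)
  have h' := h A hA
  rw [integral_toReal hκA.aemeasurable (ae_of_all _ fun ω => measure_lt_top _ _),
    integral_toReal hYA.aemeasurable (ae_of_all _ fun ω => measure_lt_top _ _)] at h'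
  refine (ENNReal.toReal_eq_toReal_iff' ?_ ?_).1 h'
  · refine ((lintegral_mono fun ω => prob_le_one).trans_lt ?_).ne (b := ∞)
    simp
  · refine ((lintegral_mono fun ω => prob_le_one).trans_lt ?_).ne (b := ∞)
    simp

/-- The mean of a measure on `[0,∞)` as the real part of a lower Lebesgue integral; both sides
vanish when the mean is infinite. -/
lemma integral_id_eq_toReal_lintegral {ν : Measure ℝ} (hν : ν (Set.Iio 0) = 0) :
    ∫ x, x ∂ν = (∫⁻ x, ENNReal.ofReal x ∂ν).toReal := by
  refine integral_eq_lintegral_of_nonneg_ae ?_ measurable_id.aestronglyMeasurable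
  filter_upwards [measure_eq_zero_iff_ae_notMem.1 hν] with x hx
  simpa using hx

lemma measurable_integral_id {Ω : Type*} {m : MeasurableSpace Ω} {κ : Ω → Measure ℝ}
    (hκ : Measurable κ) (hsupp : ∀ ω, κ ω (Set.Iio 0) = 0) :
    Measurable fun ω => ∫ x, x ∂(κ ω) := by
  simp only [fun ω => integral_id_eq_toReal_lintegral (hsupp ω)]
  exact ((Measure.measurable_lintegral ENNReal.measurable_ofReal).comp hκ).ennreal_toReal

/-- If `κ` is a regular conditional law of the nonnegative variable `Y` given `m`, then its mean is
the conditional expectation of `Y` given `m`. -/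
lemma integral_id_ae_eq_condExp {Ω : Type*} {m mΩ : MeasurableSpace Ω} (hm : m ≤ mΩ)
    {P : Measure Ω} [IsFiniteMeasure P] {κ : Ω → Measure ℝ} (hκ : Measurable[m] κ)
    (hsupp : ∀ ω, κ ω (Set.Iio 0) = 0) {Y : Ω → ℝ} (hY : Measurable Y) (hY0 : ∀ ω, 0 ≤ Y ω)
    (hYint : Integrable Y P)
    (h : ∀ S, MeasurableSet[m] S → (P.restrict S).bind κ = (P.restrict S).map Y) :
    (fun ω => ∫ x, x ∂(κ ω)) =ᵐ[P] P[Y | m] := by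
  have hκ' : Measurable κ := hκ.mono hm le_rfl
  have hL : Measurable fun ω => ∫⁻ x, ENNReal.ofReal x ∂(κ ω) :=
    (Measure.measurable_lintegral ENNReal.measurable_ofReal).comp hκ'
  have key : ∀ S, MeasurableSet[m] S →
      ∫⁻ ω in S, ∫⁻ x, ENNReal.ofReal x ∂(κ ω) ∂P = ∫⁻ ω in S, ENNReal.ofReal (Y ω) ∂P := by
    intro S hS
    rw [← Measure.lintegral_bind hκ'.aemeasurable ENNReal.measurable_ofReal.aemeasurable, h S hS,
      lintegral_map ENNReal.measurable_ofReal hY]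
  have hfin : ∫⁻ ω, ∫⁻ x, ENNReal.ofReal x ∂(κ ω) ∂P ≠ ∞ := by
    have := key Set.univ MeasurableSet.univ
    rw [Measure.restrict_univ] at this
    rw [this]
    exact hYint.lintegral_lt_top.ne
  have hint : Integrable (fun ω => ∫ x, x ∂(κ ω)) P := by
    simp only [fun ω => integral_id_eq_toReal_lintegral (hsupp ω)]
    exact integrable_toReal_of_lintegral_ne_top hL.aemeasurable hfin
  refine ae_eq_condExp_of_forall_setIntegral_eq hm hYint (fun S _ _ => hint.integrableOn)
    (fun S hS _ => ?_) (measurable_integral_id hκ hsupp).stronglyMeasurable.aestronglyMeasurable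
  simp only [fun ω => integral_id_eq_toReal_lintegral (hsupp ω)]
  rw [integral_toReal hL.aemeasurable (ae_restrict_of_ae (ae_lt_top hL hfin)), key S hS,
    integral_eq_lintegral_of_nonneg_ae (ae_of_all _ hY0) hY.aestronglyMeasurable]

/-- If `(ξ_r)_{r ∈ [0,∞]}` is a measure-valued martingale (measures on
`[0,∞)`, modelled as measures on `ℝ` giving no mass to `(-∞,0)`) with `ξ_0 = μ` a.s. and
`ξ_∞ = δ_Y` a.s., then `X_r := ∫ x ξ_r(dx)` is a nonnegative uniformly integrable
martingale with `X_∞ = Y` a.s., `X_r = E[Y | 𝔉_r]` a.s., and the law of `Y` is `μ`. -/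
theorem stmt_1 {Ω : Type*} {mΩ : MeasurableSpace Ω} {P : Measure Ω}
    [IsProbabilityMeasure P] (ℱ : Filtration ℝ≥0∞ mΩ)
    (μ : Measure ℝ) [IsProbabilityMeasure μ]
    (hμsupp : μ (Set.Iio 0) = 0)
    (hμmom : Integrable (fun x : ℝ => x) μ)
    (ξ : ℝ≥0∞ → Ω → Measure ℝ)
    (hprob : ∀ r ω, IsProbabilityMeasure (ξ r ω))
    (hsupp : ∀ r ω, ξ r ω (Set.Iio 0) = 0)
    (hadapted : ∀ r, ∀ A : Set ℝ, MeasurableSet A →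
      Measurable[ℱ r] fun ω => (ξ r ω A).toReal)
    (hmoment : ∀ r, ∀ᵐ ω ∂P, Integrable (fun x : ℝ => x) (ξ r ω))
    (hmart : ∀ A : Set ℝ, MeasurableSet A →
      Martingale (fun r ω => (ξ r ω A).toReal) ℱ P)
    (hinit : ∀ᵐ ω ∂P, ξ 0 ω = μ)
    (Y : Ω → ℝ) (hY : Measurable Y) (hY0 : ∀ ω, 0 ≤ Y ω)
    (hterm : ∀ᵐ ω ∂P, ξ ⊤ ω = Measure.dirac (Y ω)) :
    Martingale (fun r ω => ∫ x, x ∂(ξ r ω)) ℱ P ∧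
    (∀ r ω, 0 ≤ ∫ x, x ∂(ξ r ω)) ∧
    UniformIntegrable (fun r ω => ∫ x, x ∂(ξ r ω)) 1 P ∧
    (∀ᵐ ω ∂P, ∫ x, x ∂(ξ ⊤ ω) = Y ω) ∧
    (∀ r, (fun ω => ∫ x, x ∂(ξ r ω)) =ᵐ[P] P[Y | ℱ r]) ∧
    P.map Y = μ := by
  have hmeas : ∀ r, Measurable[ℱ r] (ξ r) := fun r =>
    measurable_measure_of_measurable_toReal (hprob r) (hadapted r)
  have hbind : ∀ r S, MeasurableSet[ℱ r] S →
      (P.restrict S).bind (ξ r) = (P.restrict S).map Y := by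
    intro r S hS
    refine restrict_bind_eq_map (hprob r) ((hmeas r).mono (ℱ.le r) le_rfl) hY fun A hA => ?_
    rw [(hmart A hA).setIntegral_eq le_top hS]
    refine integral_congr_ae (ae_restrict_of_ae ?_)
    filter_upwards [hterm] with ω hω
    rw [hω]
  have hlaw : P.map Y = μ := by
    have h0 := hbind 0 Set.univ MeasurableSet.univ
    rw [Measure.restrict_univ] at h0
    rw [← h0]
    ext A hA
    rw [Measure.bind_apply hA ((hmeas 0).mono (ℱ.le 0) le_rfl).aemeasurable,
      lintegral_congr_ae (g := fun _ => μ A) (by filter_upwards [hinit] with ω hω; rw [hω])]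
    simp
  have hYint : Integrable Y P := by
    rw [← hlaw] at hμmom
    exact hμmom.comp_measurable hY
  have hcond : ∀ r, (fun ω => ∫ x, x ∂(ξ r ω)) =ᵐ[P] P[Y | ℱ r] := fun r =>
    integral_id_ae_eq_condExp (ℱ.le r) (hmeas r) (hsupp r) hY hY0 hYint (hbind r)
  refine ⟨(martingale_condExp Y ℱ P).congr
      (fun r => (measurable_integral_id (hmeas r) (hsupp r)).stronglyMeasurable)
      fun r => (hcond r).symm, fun r ω => ?_,
    (hYint.uniformIntegrable_condExp ℱ.le).ae_eq fun r => (hcond r).symm, ?_, hcond, hlaw⟩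
  · rw [integral_id_eq_toReal_lintegral (hsupp r ω)]
    exact ENNReal.toReal_nonneg
  · filter_upwards [hterm] with ω hω
    rw [hω, integral_dirac]
end

section
/- Let (Ω, 𝔉, (𝔉_r)_{r ∈ [0,∞]}, P) be a filtered probability space, μ a Borel probability measure on [0,∞) with ∫ x μ(dx) < ∞, and (ξ_r)_{r ∈ [0,∞]} an adapted process of Borel probability measures on [0,∞) with finite first moment such that (ξ_r(A))_{r ∈ [0,∞]} is a martingale for every Borel set A ⊆ [0,∞), ξ_0 = μ almost surely, and ξ_∞ = δ_Y almost surely for some random variable Y : Ω → [0,∞). Then for every Lipschitz function f : [0,∞) → ℝ with Lipschitz constant 1, X^f_r := ∫ f(x) ξ_r(dx), r ∈ [0,∞], defines a uniformly integrable martingale with X^f_0 = ∫ f dμ almost surely, X^f_∞ = f(Y) almost surely, and the law of X^f_∞ under P equals the pushforward measure f_*μ. -/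
open MeasureTheory Filter
open scoped NNReal ENNReal

/-- If `κ` is a version of the conditional distribution of `Y` given `m`, then averaging `κ` over
an `m`-measurable set yields the law of `Y` on that set. -/
lemma comp_restrict_eq_map_restrict_of_ae_eq_condExp {Ω E : Type*} {m mΩ : MeasurableSpace Ω}
    [MeasurableSpace E] {P : Measure Ω} [IsFiniteMeasure P] (hm : m ≤ mΩ)
    (κ : ProbabilityTheory.Kernel Ω E) [ProbabilityTheory.IsFiniteKernel κ]
    {Y : Ω → E} (hY : Measurable Y)
    (hκ : ∀ A, MeasurableSet A →
      (fun ω => (κ ω).real A) =ᵐ[P] P[(Y ⁻¹' A).indicator (fun _ => (1 : ℝ)) | m])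
    {s : Set Ω} (hs : MeasurableSet[m] s) :
    (P.restrict s).bind κ = (P.restrict s).map Y := by
  ext A hA
  rw [Measure.bind_apply hA κ.aemeasurable, Measure.map_apply hY hA,
    ← ENNReal.toReal_eq_toReal_iff' _ (measure_ne_top _ _)]
  · calc (∫⁻ ω in s, κ ω A ∂P).toReal = ∫ ω in s, (κ ω).real A ∂P :=
          (integral_toReal (κ.measurable_coe hA).aemeasurable
            (ae_of_all _ fun ω => measure_lt_top _ _)).symm
      _ = ∫ ω in s, (P[(Y ⁻¹' A).indicator (fun _ => (1 : ℝ)) | m]) ω ∂P :=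
          integral_congr_ae (ae_restrict_of_ae (hκ A hA))
      _ = ∫ ω in s, (Y ⁻¹' A).indicator (fun _ => (1 : ℝ)) ω ∂P :=
          setIntegral_condExp hm ((integrable_const _).indicator (hY hA)) hs
      _ = ((P.restrict s) (Y ⁻¹' A)).toReal := by
          rw [integral_indicator_const _ (hY hA), smul_eq_mul, mul_one, Measure.real]
  · have h : ∫⁻ ω in s, κ ω A ∂P = (P.restrict s).bind κ A :=
      (Measure.bind_apply hA κ.aemeasurable).symm
    rw [h]
    exact measure_ne_top _ _

/-- Integrating against a version of the conditional distribution of `Y` given `m` computes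
conditional expectations of functions of `Y`. -/
lemma integral_kernel_ae_eq_condExp_comp {Ω E : Type*} {m mΩ : MeasurableSpace Ω}
    [MeasurableSpace E] {P : Measure Ω} [IsFiniteMeasure P] (hm : m ≤ mΩ)
    (κ : ProbabilityTheory.Kernel Ω E) [ProbabilityTheory.IsFiniteKernel κ]
    {Y : Ω → E} (hY : Measurable Y)
    (hκ : ∀ A, MeasurableSet A →
      (fun ω => (κ ω).real A) =ᵐ[P] P[(Y ⁻¹' A).indicator (fun _ => (1 : ℝ)) | m])
    {f : E → ℝ} (hf : StronglyMeasurable f) (hfY : Integrable (fun ω => f (Y ω)) P)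
    (hκf : StronglyMeasurable[m] fun ω => ∫ x, f x ∂κ ω) :
    (fun ω => ∫ x, f x ∂κ ω) =ᵐ[P] P[fun ω => f (Y ω) | m] := by
  have hbind {s : Set Ω} (hs : MeasurableSet[m] s) :
      (P.restrict s).bind κ = (P.restrict s).map Y :=
    comp_restrict_eq_map_restrict_of_ae_eq_condExp hm κ hY hκ hs
  have hf_bind {s : Set Ω} (hs : MeasurableSet[m] s) :
      Integrable f ((P.restrict s).bind κ) := by
    rw [hbind hs, integrable_map_measure hf.aestronglyMeasurable hY.aemeasurable]
    exact hfY.integrableOn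
  simp_rw [Measure.comp_eq_comp_const_apply] at hf_bind
  refine ae_eq_condExp_of_forall_setIntegral_eq hm hfY (fun s hs _ => ?_) (fun s hs _ => ?_)
    hκf.aestronglyMeasurable
  · simpa [IntegrableOn] using (hf_bind hs).integral_comp
  · have h := ProbabilityTheory.Kernel.integral_comp (hf_bind hs)
    rw [← Measure.comp_eq_comp_const_apply, hbind hs,
      integral_map hY.aemeasurable hf.aestronglyMeasurable] at h
    simpa using h.symm

/-- If `(ξ_r)_{r ∈ [0,∞]}` is a measure-valued martingale (measures on
`[0,∞)`, modelled as measures on `ℝ` giving no mass to `(-∞,0)`) with `ξ_0 = μ` a.s. and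
`ξ_∞ = δ_Y` a.s., then for every `1`-Lipschitz `f`, `X^f_r := ∫ f dξ_r` is a uniformly
integrable martingale with `X^f_0 = ∫ f dμ` a.s., `X^f_∞ = f(Y)` a.s., and the law of
`X^f_∞` is the pushforward `f_*μ`. -/
theorem stmt_2 {Ω : Type*} {mΩ : MeasurableSpace Ω} {P : Measure Ω}
    [IsProbabilityMeasure P] (ℱ : Filtration ℝ≥0∞ mΩ)
    (μ : Measure ℝ) [IsProbabilityMeasure μ]
    (hμsupp : μ (Set.Iio 0) = 0)
    (hμmom : Integrable (fun x : ℝ => x) μ)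
    (ξ : ℝ≥0∞ → Ω → Measure ℝ)
    (hprob : ∀ r ω, IsProbabilityMeasure (ξ r ω))
    (hsupp : ∀ r ω, ξ r ω (Set.Iio 0) = 0)
    (hadapted : ∀ r, ∀ A : Set ℝ, MeasurableSet A →
      Measurable[ℱ r] fun ω => (ξ r ω A).toReal)
    (hmoment : ∀ r, ∀ᵐ ω ∂P, Integrable (fun x : ℝ => x) (ξ r ω))
    (hmart : ∀ A : Set ℝ, MeasurableSet A →
      Martingale (fun r ω => (ξ r ω A).toReal) ℱ P)
    (hinit : ∀ᵐ ω ∂P, ξ 0 ω = μ)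
    (Y : Ω → ℝ) (hY : Measurable Y) (hY0 : ∀ ω, 0 ≤ Y ω)
    (hterm : ∀ᵐ ω ∂P, ξ ⊤ ω = Measure.dirac (Y ω))
    (f : ℝ → ℝ) (hf : LipschitzWith 1 f) :
    Martingale (fun r ω => ∫ x, f x ∂(ξ r ω)) ℱ P ∧
    UniformIntegrable (fun r ω => ∫ x, f x ∂(ξ r ω)) 1 P ∧
    (∀ᵐ ω ∂P, ∫ x, f x ∂(ξ 0 ω) = ∫ x, f x ∂μ) ∧
    (∀ᵐ ω ∂P, ∫ x, f x ∂(ξ ⊤ ω) = f (Y ω)) ∧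
    P.map (fun ω => ∫ x, f x ∂(ξ ⊤ ω)) = μ.map f := by
  have hmeas (r : ℝ≥0∞) : Measurable[ℱ r] (ξ r) := by
    refine @Measure.measurable_of_measurable_coe _ _ _ (ℱ r) _ fun A hA => ?_
    have h := (hadapted r A hA).ennreal_ofReal
    simpa only [ENNReal.ofReal_toReal (measure_ne_top _ _)] using h
  let κ (r : ℝ≥0∞) : ProbabilityTheory.Kernel Ω ℝ := ⟨ξ r, (hmeas r).mono (ℱ.le r) le_rfl⟩
  have hκ_prob (r : ℝ≥0∞) : ProbabilityTheory.IsMarkovKernel (κ r) := ⟨hprob r⟩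
  have hκ (r : ℝ≥0∞) (A : Set ℝ) (hA : MeasurableSet A) : (fun ω => (κ r ω).real A)
      =ᵐ[P] P[(Y ⁻¹' A).indicator (fun _ => (1 : ℝ)) | ℱ r] := by
    refine ((hmart A hA).2 r ⊤ le_top).symm.trans (condExp_congr_ae ?_)
    filter_upwards [hterm] with ω hω
    by_cases h : Y ω ∈ A <;> simp [hω, Measure.dirac_apply' _ hA, h]
  have hlaw : P.map Y = μ := by
    have h := comp_restrict_eq_map_restrict_of_ae_eq_condExp (ℱ.le 0) (κ 0) hY (hκ 0)
      MeasurableSet.univ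
    rw [Measure.restrict_univ] at h
    rw [← h, Measure.bind_congr_right (f := κ 0) (g := fun _ => μ) hinit, Measure.bind_const]
    simp
  have hfm : StronglyMeasurable f := hf.continuous.stronglyMeasurable
  have hfμ : Integrable f μ := by
    refine (hμmom.norm.add (integrable_const ‖f 0‖)).mono' hfm.aestronglyMeasurable
      (ae_of_all _ fun x => ?_)
    have h1 := hf.norm_sub_le x 0
    have h2 := norm_le_norm_sub_add (f x) (f 0)
    simp only [NNReal.coe_one, one_mul, sub_zero] at h1
    simp only [Pi.add_apply]
    linarith
  have hfY : Integrable (fun ω => f (Y ω)) P := by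
    rw [← hlaw] at hfμ
    exact hfμ.comp_measurable hY
  have hadp (r : ℝ≥0∞) : StronglyMeasurable[ℱ r] fun ω => ∫ x, f x ∂(ξ r ω) :=
    StronglyMeasurable.integral_kernel
      (κ := (@ProbabilityTheory.Kernel.mk _ _ (ℱ r) _ (ξ r) (hmeas r))) hfm
  have hcond (r : ℝ≥0∞) : (fun ω => ∫ x, f x ∂(ξ r ω)) =ᵐ[P] P[fun ω => f (Y ω) | ℱ r] :=
    integral_kernel_ae_eq_condExp_comp (ℱ.le r) (κ r) hY (hκ r) hfm hfY (hadp r)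
  have hlast : ∀ᵐ ω ∂P, ∫ x, f x ∂(ξ ⊤ ω) = f (Y ω) := by
    filter_upwards [hterm] with ω hω
    rw [hω, integral_dirac]
  refine ⟨⟨hadp, fun r s hrs => ?_⟩, ?_, ?_, hlast, ?_⟩
  · exact (condExp_congr_ae (hcond s)).trans
      ((condExp_condExp_of_le (ℱ.mono hrs) (ℱ.le s)).trans (hcond r).symm)
  · exact (uniformIntegrable_congr_ae hcond).2 (hfY.uniformIntegrable_condExp ℱ.le)
  · filter_upwards [hinit] with ω hω
    rw [hω]
  · rw [Measure.map_congr hlast, ← hlaw, Measure.map_map hfm.measurable hY, Function.comp_def]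
end

section
/- Let T > 0, let (Ω, 𝔉, (𝔉_t)_{t ∈ [0,T]}, P) be a filtered probability space, and let (S_t)_{t ∈ [0,T]} be a right-continuous (càdlàg) martingale. Let F : ℝ → ℝ be convex and Lipschitz. Then for every t ∈ [0,T] and every a ∈ ℝ, E[ F( a + ∫_t^T S_u du ) ] ≤ E[ F( a + (T − t) S_T ) ]. In particular, taking t = 0 and a = 0, E[ F( ∫_0^T S_u du ) ] ≤ ∫ F(T x) μ(dx), where μ is the law of S_T; and equality holds whenever almost surely S_u = S_T for all u ∈ [0,T]. -/
open MeasureTheory Filter Set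
open scoped NNReal

/-- A process with measurable marginals and right-continuous paths is jointly measurable. -/
lemma measurable_uncurry_of_right_continuous {Ω : Type*} [MeasurableSpace Ω] {X : ℝ → Ω → ℝ}
    (hmeas : ∀ u, Measurable (X u))
    (hrc : ∀ ω u, ContinuousWithinAt (fun v => X v ω) (Ici u) u) :
    Measurable (Function.uncurry X) := by
  have hlim (u : ℝ) : Tendsto (fun n : ℕ => (⌈u * ((n : ℝ) + 1)⌉ : ℝ) / ((n : ℝ) + 1)) atTop
      (nhdsWithin u (Ici u)) := by
    refine tendsto_nhdsWithin_iff.2 ⟨?_, Eventually.of_forall fun n => ?_⟩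
    · refine tendsto_of_tendsto_of_tendsto_of_le_of_le (g := fun _ => u)
        (h := fun n : ℕ => u + 1 / ((n : ℝ) + 1)) tendsto_const_nhds ?_ (fun n => ?_) (fun n => ?_)
      · simpa using (tendsto_const_nhds (x := u)).add
          (tendsto_one_div_add_atTop_nhds_zero_nat (𝕜 := ℝ))
      · exact (le_div_iff₀ (by positivity)).2 (Int.le_ceil _)
      · have hn : (0 : ℝ) < (n : ℝ) + 1 := by positivity
        have h := (Int.ceil_lt_add_one (u * ((n : ℝ) + 1))).le
        have h' : u + 1 / ((n : ℝ) + 1) = (u * ((n : ℝ) + 1) + 1) / ((n : ℝ) + 1) := by field_simp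
        change _ ≤ u + 1 / ((n : ℝ) + 1)
        rw [h']
        gcongr
    · exact mem_Ici.2 <| (le_div_iff₀ (by positivity)).2 (Int.le_ceil _)
  refine measurable_of_tendsto_metrizable
    (f := fun (n : ℕ) (p : ℝ × Ω) => X ((⌈p.1 * ((n : ℝ) + 1)⌉ : ℝ) / ((n : ℝ) + 1)) p.2)
    (fun n => ?_) (tendsto_pi_nhds.2 fun p => (hrc p.2 p.1).tendsto.comp (hlim p.1))
  have h : Measurable fun q : ℤ × Ω => X ((q.1 : ℝ) / ((n : ℝ) + 1)) q.2 :=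
    measurable_from_prod_countable_right fun k => hmeas ((k : ℝ) / ((n : ℝ) + 1))
  exact h.comp
    ((Int.measurable_ceil.comp (measurable_fst.mul_const _)).prodMk measurable_snd)

/-- A Lipschitz function of an integrable function is integrable on a finite measure space. -/
lemma LipschitzWith.integrable_comp_of_isFiniteMeasure {α : Type*} [MeasurableSpace α]
    {ν : Measure α} [IsFiniteMeasure ν] {K : ℝ≥0} {F : ℝ → ℝ} (hF : LipschitzWith K F)
    {f : α → ℝ} (hf : Integrable f ν) : Integrable (fun x => F (f x)) ν := by
  refine Integrable.mono' ((hf.norm.const_mul (K : ℝ)).add (integrable_const ‖F 0‖))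
    (hF.continuous.comp_aestronglyMeasurable hf.aestronglyMeasurable)
    (Eventually.of_forall fun x => ?_)
  have h := hF.norm_sub_le (f x) 0
  rw [sub_zero] at h
  have h' := norm_add_le (F (f x) - F 0) (F 0)
  rw [sub_add_cancel] at h'
  exact h'.trans (by simpa using h)

/-- The integrated form of the conditional Jensen inequality, for a convex Lipschitz function. -/
lemma integral_comp_le_of_condExp_ae_eq {Ω : Type*} {m mΩ : MeasurableSpace Ω} {P : Measure Ω}
    [IsFiniteMeasure P] (hm : m ≤ mΩ) {G : ℝ → ℝ} {K : ℝ≥0} (hconv : ConvexOn ℝ Set.univ G)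
    (hlip : LipschitzWith K G) {X Y : Ω → ℝ} (hX : Integrable X P) (hY : Integrable Y P)
    (h : P[Y | m] =ᵐ[P] X) :
    ∫ ω, G (X ω) ∂P ≤ ∫ ω, G (Y ω) ∂P := by
  have hGY : Integrable (G ∘ Y) P := hlip.integrable_comp_of_isFiniteMeasure hY
  calc ∫ ω, G (X ω) ∂P ≤ ∫ ω, (P[G ∘ Y | m]) ω ∂P := by
        refine integral_mono_ae (hlip.integrable_comp_of_isFiniteMeasure hX)
          integrable_condExp ?_
        filter_upwards [h, ConvexOn.map_condExp_le_univ hm hconv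
          hlip.continuous.lowerSemicontinuous hY hGY] with ω h₁ h₂
        simpa [h₁] using h₂
    _ = ∫ ω, G (Y ω) ∂P := integral_condExp hm

/-- If the expectation of every convex Lipschitz function of `X u` is dominated by that of `Y`,
then so is the expectation of a convex Lipschitz function of the time integral of `X`. -/
lemma integral_comp_setIntegral_le {Ω : Type*} {mΩ : MeasurableSpace Ω} {P : Measure Ω}
    [IsProbabilityMeasure P] {X : ℝ → Ω → ℝ} {Y : Ω → ℝ}
    (hmeas : Measurable (Function.uncurry X)) {t T : ℝ} (htT : t ≤ T)
    (hX : ∀ u ∈ Icc t T, Integrable (X u) P)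
    (hdom : ∀ G : ℝ → ℝ, ConvexOn ℝ Set.univ G → (∃ K : ℝ≥0, LipschitzWith K G) →
      ∀ u ∈ Icc t T, ∫ ω, G (X u ω) ∂P ≤ ∫ ω, G (Y ω) ∂P)
    {F : ℝ → ℝ} (hconv : ConvexOn ℝ Set.univ F) {K : ℝ≥0} (hlip : LipschitzWith K F) (a : ℝ) :
    ∫ ω, F (a + ∫ u in Icc t T, X u ω) ∂P ≤ ∫ ω, F (a + (T - t) * Y ω) ∂P := by
  rcases htT.eq_or_lt with rfl | htT
  · simp
  have hc : 0 < T - t := sub_pos.2 htT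
  set ν : Measure ℝ := volume.restrict (Icc t T) with hν
  have hνreal : ν.real univ = T - t := by simp [hν, measureReal_def, hc.le]
  have : NeZero ν := ⟨fun h => by simp [h] at hνreal; linarith⟩
  have hmem : ∀ᵐ u ∂ν, u ∈ Icc t T := ae_restrict_mem measurableSet_Icc
  have hXint : Integrable (Function.uncurry X) (ν.prod P) := by
    refine (integrable_prod_iff hmeas.aestronglyMeasurable).2 ⟨hmem.mono hX, ?_⟩
    refine Integrable.mono' (integrable_const (∫ ω, ‖Y ω‖ ∂P))
      hmeas.aestronglyMeasurable.norm.integral_prod_right' (hmem.mono fun u hu => ?_)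
    rw [Real.norm_of_nonneg (by positivity)]
    exact hdom norm (convexOn_norm convex_univ) ⟨1, lipschitzWith_one_norm⟩ u hu
  set G : ℝ → ℝ := fun x => F (a + (T - t) * x) with hG
  have hGconv : ConvexOn ℝ Set.univ G := by
    refine ⟨convex_univ, fun x _ y _ p q hp hq hpq => ?_⟩
    have h := hconv.2 (mem_univ (a + (T - t) * x)) (mem_univ (a + (T - t) * y)) hp hq hpq
    simp only [smul_eq_mul, hG] at h ⊢
    refine le_of_eq_of_le (congrArg F ?_) h
    linear_combination (-a) * hpq
  have hGlip : LipschitzWith (K * ‖T - t‖₊) G := by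
    refine hlip.comp (LipschitzWith.of_dist_le_mul fun x y => le_of_eq ?_)
    simp [Real.dist_eq, ← mul_sub, abs_mul]
  have hGint : Integrable (Function.uncurry fun u ω => G (X u ω)) (ν.prod P) :=
    hGlip.integrable_comp_of_isFiniteMeasure hXint
  have hjensen : ∀ᵐ ω ∂P,
      F (a + ∫ u, X u ω ∂ν) ≤ (T - t)⁻¹ * ∫ u, G (X u ω) ∂ν := by
    filter_upwards [hXint.prod_left_ae, hGint.prod_left_ae] with ω h₁ h₂
    have h := hGconv.map_average_le (μ := ν) (f := fun u => X u ω) hGlip.continuous.continuousOn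
      isClosed_univ (by simp) h₁ h₂
    simpa [average_eq, hνreal, hG, mul_inv_cancel_left₀ hc.ne'] using h
  calc ∫ ω, F (a + ∫ u, X u ω ∂ν) ∂P
      ≤ ∫ ω, (T - t)⁻¹ * ∫ u, G (X u ω) ∂ν ∂P :=
        integral_mono_ae (hlip.integrable_comp_of_isFiniteMeasure
          ((integrable_const a).add hXint.integral_prod_right))
          (hGint.integral_prod_right.const_mul _) hjensen
    _ = (T - t)⁻¹ * ∫ u, ∫ ω, G (X u ω) ∂P ∂ν := by
        rw [integral_const_mul, integral_integral_swap hGint]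
    _ ≤ (T - t)⁻¹ * ∫ _, ∫ ω, G (Y ω) ∂P ∂ν := by
        refine mul_le_mul_of_nonneg_left ?_ (inv_nonneg.2 hc.le)
        exact integral_mono_ae hGint.integral_prod_left (integrable_const _)
          (hmem.mono fun u hu => hdom G hGconv ⟨_, hGlip⟩ u hu)
    _ = ∫ ω, F (a + (T - t) * Y ω) ∂P := by
        rw [integral_const, hνreal, smul_eq_mul, inv_mul_cancel_left₀ hc.ne']

/-- For a càdlàg martingale `(S_t)_{t ∈ [0,T]}` and a convex Lipschitz
function `F`, one has `E[F(a + ∫_t^T S_u du)] ≤ E[F(a + (T−t) S_T)]` for every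
`t ∈ [0,T]`, `a ∈ ℝ`; in particular `E[F(∫_0^T S_u du)] ≤ ∫ F(Tx) μ(dx)` where `μ` is
the law of `S_T`, with equality if a.s. `S_u = S_T` for all `u ∈ [0,T]`. -/
theorem stmt_6 {Ω : Type*} {mΩ : MeasurableSpace Ω} {P : Measure Ω}
    [IsProbabilityMeasure P] (T : ℝ) (hT : 0 < T)
    (ℱ : Filtration ℝ mΩ) (S : ℝ → Ω → ℝ)
    (hadapt : ∀ t ∈ Icc (0 : ℝ) T, StronglyMeasurable[ℱ t] (S t))
    (hint : ∀ t ∈ Icc (0 : ℝ) T, Integrable (S t) P)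
    (hmart : ∀ s ∈ Icc (0 : ℝ) T, ∀ t ∈ Icc (0 : ℝ) T, s ≤ t →
      P[S t | ℱ s] =ᵐ[P] S s)
    -- càdlàg paths: right-continuity on [0,T) and left limits on (0,T]
    (hrc : ∀ ω, ∀ t ∈ Ico (0 : ℝ) T, ContinuousWithinAt (fun u => S u ω) (Icc t T) t)
    (hll : ∀ ω, ∀ t ∈ Ioc (0 : ℝ) T, ∃ l : ℝ,
      Tendsto (fun u => S u ω) (nhdsWithin t (Ico 0 t)) (nhds l))
    (F : ℝ → ℝ) (hconv : ConvexOn ℝ Set.univ F) (hlip : ∃ K : ℝ≥0, LipschitzWith K F)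
    (μ : Measure ℝ) (hμ : μ = P.map (S T)) :
    (∀ t ∈ Icc (0 : ℝ) T, ∀ a : ℝ,
      ∫ ω, F (a + ∫ u in Icc t T, S u ω) ∂P ≤ ∫ ω, F (a + (T - t) * S T ω) ∂P) ∧
    (∫ ω, F (∫ u in Icc (0 : ℝ) T, S u ω) ∂P ≤ ∫ y, F (T * y) ∂μ) ∧
    ((∀ᵐ ω ∂P, ∀ u ∈ Icc (0 : ℝ) T, S u ω = S T ω) →
      ∫ ω, F (∫ u in Icc (0 : ℝ) T, S u ω) ∂P = ∫ y, F (T * y) ∂μ) := by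
  obtain ⟨K, hK⟩ := hlip
  have hTmem : T ∈ Icc (0 : ℝ) T := right_mem_Icc.2 hT.le
  have hproj (u : ℝ) : max 0 (min u T) ∈ Icc (0 : ℝ) T :=
    ⟨le_max_left _ _, max_le hT.le (min_le_right _ _)⟩
  have hproj_eq {u : ℝ} (hu : u ∈ Icc (0 : ℝ) T) : max 0 (min u T) = u := by
    rw [min_eq_left hu.2, max_eq_right hu.1]
  have hjoint : Measurable (Function.uncurry fun u ω => S (max 0 (min u T)) ω) := by
    refine measurable_uncurry_of_right_continuous
      (fun u => ((hadapt _ (hproj u)).mono (ℱ.le _)).measurable) fun ω u => ?_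
    have hcont : ContinuousWithinAt (fun v => S v ω) (Icc (max 0 (min u T)) T)
        (max 0 (min u T)) := by
      rcases (hproj u).2.eq_or_lt with h | h
      · rw [h, Icc_self]
        exact continuousWithinAt_singleton
      · exact hrc ω _ ⟨(hproj u).1, h⟩
    refine hcont.comp (f := fun v : ℝ => max 0 (min v T)) (by fun_prop) fun v hv => ?_
    exact ⟨max_le_max le_rfl (min_le_min hv le_rfl), (hproj v).2⟩
  have hmain : ∀ t ∈ Icc (0 : ℝ) T, ∀ a : ℝ,
      ∫ ω, F (a + ∫ u in Icc t T, S u ω) ∂P ≤ ∫ ω, F (a + (T - t) * S T ω) ∂P := by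
    intro t ht a
    have h := integral_comp_setIntegral_le (P := P) (Y := S T) hjoint ht.2
      (fun u _ => hint _ (hproj u))
      (fun G hG ⟨_, hL⟩ u _ => integral_comp_le_of_condExp_ae_eq (ℱ.le _) hG hL
        (hint _ (hproj u)) (hint T hTmem) (hmart _ (hproj u) T hTmem (hproj u).2)) hconv hK a
    have heq (ω : Ω) : ∫ u in Icc t T, S (max 0 (min u T)) ω = ∫ u in Icc t T, S u ω :=
      setIntegral_congr_fun measurableSet_Icc fun u hu => by
        simp only [hproj_eq ⟨ht.1.trans hu.1, hu.2⟩]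
    simpa only [heq] using h
  have hlaw : ∫ y, F (T * y) ∂μ = ∫ ω, F (T * S T ω) ∂P := by
    rw [hμ]
    exact integral_map (hint T hTmem).aemeasurable
      (hK.continuous.comp (continuous_const.mul continuous_id)).aestronglyMeasurable
  refine ⟨hmain, ?_, fun hconst => ?_⟩
  · rw [hlaw]
    simpa using hmain 0 (left_mem_Icc.2 hT.le) 0
  · rw [hlaw]
    refine integral_congr_ae (hconst.mono fun ω hω => ?_)
    have h : ∫ u in Icc (0 : ℝ) T, S u ω = T * S T ω := by
      rw [setIntegral_congr_fun measurableSet_Icc hω]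
      simp [hT.le]
    simp only [h]
end

section
/- Let T > 0, let (S_t)_{t ∈ [0,T]} be a càdlàg martingale on a filtered probability space (Ω, 𝔉, (𝔉_t)_{t ∈ [0,T]}, P), and let F : ℝ → [0,∞) be continuous. For n ≥ 1 define S^n_t := S_{⌊nt/T⌋T/n} and 𝔊^n_t := 𝔉_{⌊nt/T⌋T/n}. Then: (1) for each n, (S^n_t)_{t ∈ [0,T]} is a martingale with respect to (𝔊^n_t) with S^n_T = S_T; (2) A^n_T := ∫_0^T S^n_t dt converges almost surely to A_T := ∫_0^T S_t dt as n → ∞; (3) E[ F(A_T) ] ≤ liminf_{n→∞} E[ F(A^n_T) ]. -/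
open MeasureTheory Filter Set
open scoped NNReal ENNReal

/-- Sampling times `⌊nt/T⌋T/n` of points of `[0,T]` stay in `[0,t]`. -/
theorem floor_grid_mem_Icc {T t : ℝ} (hT : 0 < T) (ht : 0 ≤ t) (n : ℕ) :
    (⌊(n : ℝ) * t / T⌋ : ℝ) * T / n ∈ Icc 0 t := by
  rcases Nat.eq_zero_or_pos n with rfl | hn
  · simpa using ht
  have hn' : (0 : ℝ) < n := by exact_mod_cast hn
  have h0 : (0 : ℝ) ≤ (⌊(n : ℝ) * t / T⌋ : ℝ) := by
    exact_mod_cast Int.floor_nonneg.2 (by positivity)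
  refine ⟨by positivity, ?_⟩
  rw [div_le_iff₀ hn', ← le_div_iff₀ hT, mul_comm t]
  exact Int.floor_le _

/-- The sampling times `⌊nt/T⌋T/n` increase with `t`. -/
theorem floor_grid_mono {T s t : ℝ} (hT : 0 < T) (hst : s ≤ t) (n : ℕ) :
    (⌊(n : ℝ) * s / T⌋ : ℝ) * T / n ≤ (⌊(n : ℝ) * t / T⌋ : ℝ) * T / n := by
  have : (⌊(n : ℝ) * s / T⌋ : ℝ) ≤ (⌊(n : ℝ) * t / T⌋ : ℝ) := by
    exact_mod_cast Int.floor_mono (by gcongr)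
  gcongr

theorem tendsto_floor_grid {T t : ℝ} (hT : 0 < T) (ht : 0 ≤ t) :
    Tendsto (fun n : ℕ => (⌊(n : ℝ) * t / T⌋ : ℝ) * T / n) atTop (nhds t) := by
  have h1 : Tendsto (fun n : ℕ => t - T / n) atTop (nhds t) := by
    simpa using tendsto_const_nhds.sub (tendsto_const_div_atTop_nhds_zero_nat T)
  refine tendsto_of_tendsto_of_tendsto_of_le_of_le' h1 tendsto_const_nhds ?_
    (Eventually.of_forall fun n => (floor_grid_mem_Icc hT ht n).2)
  filter_upwards [eventually_gt_atTop 0] with n hn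
  have hn' : (0 : ℝ) < n := by exact_mod_cast hn
  have h := Int.sub_one_lt_floor ((n : ℝ) * t / T)
  have h2 : ((n : ℝ) * t / T - 1) * T / n = t - T / n := by field_simp
  rw [← h2]
  gcongr

/-- The points at which a real function stays above a level `z > f t` on a left neighbourhood
form a countable set. -/
theorem countable_setOf_lt_eventually_left (f : ℝ → ℝ) :
    {t | ∃ z, f t < z ∧ ∃ a < t, ∀ y ∈ Ioo a t, z ≤ f y}.Countable := by
  have h (q : ℚ) := countable_image_gt_image_Iio_within (Ioi (q : ℝ)) f
  refine (countable_iUnion h).mono ?_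
  rintro t ⟨z, hz, a, ha, hy⟩
  obtain ⟨q, hq, hqt⟩ := exists_rat_btwn ha
  exact mem_iUnion.2 ⟨q, hqt, z, hz, fun y hyq hyt => hy y ⟨hq.trans hyq, hyt⟩⟩

/-- A function with left limits on `(0,T]` is left-continuous off a countable set. -/
theorem countable_not_tendsto_left {T : ℝ} {f : ℝ → ℝ}
    (hll : ∀ t ∈ Ioc (0 : ℝ) T, ∃ l : ℝ, Tendsto f (nhdsWithin t (Ico 0 t)) (nhds l)) :
    {t ∈ Ioc (0 : ℝ) T | ¬ Tendsto f (nhdsWithin t (Ico 0 t)) (nhds (f t))}.Countable := by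
  refine ((countable_setOf_lt_eventually_left f).union
    (countable_setOf_lt_eventually_left (fun t => -f t))).mono ?_
  rintro t ⟨ht, hne⟩
  obtain ⟨l, hl⟩ := hll t ht
  have key {p : ℝ → Prop} (h : ∀ᶠ y in nhdsWithin t (Ico 0 t), p y) :
      ∃ a < t, ∀ y ∈ Ioo a t, p y := by
    rw [nhdsWithin_Ico_eq_nhdsLT ht.1] at h
    obtain ⟨a, ha, h⟩ := (mem_nhdsLT_iff_exists_Ioo_subset).1 h
    exact ⟨a, ha, h⟩
  rcases lt_trichotomy (f t) l with h | h | h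
  · obtain ⟨z, hz, hzl⟩ := exists_between h
    exact .inl ⟨z, hz, key (hl.eventually_const_le hzl)⟩
  · exact absurd (h ▸ hl) hne
  · obtain ⟨z, hz, hzl⟩ := exists_between h
    exact .inr ⟨-z, neg_lt_neg hzl, key ((hl.eventually_le_const hz).mono fun y => neg_le_neg)⟩

/-- A càdlàg function on a compact interval is bounded. -/
theorem exists_bound_of_cadlag {T : ℝ} {f : ℝ → ℝ}
    (hrc : ∀ t ∈ Ico (0 : ℝ) T, ContinuousWithinAt f (Icc t T) t)
    (hll : ∀ t ∈ Ioc (0 : ℝ) T, ∃ l : ℝ, Tendsto f (nhdsWithin t (Ico 0 t)) (nhds l)) :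
    ∃ C, ∀ t ∈ Icc (0 : ℝ) T, ‖f t‖ ≤ C := by
  refine isCompact_Icc.induction_on (p := fun s => ∃ C, ∀ t ∈ s, ‖f t‖ ≤ C) ⟨0, by simp⟩
    (fun s t hst ⟨C, hC⟩ => ⟨C, fun u hu => hC u (hst hu)⟩) ?_ ?_
  · rintro s t ⟨C, hC⟩ ⟨D, hD⟩
    exact ⟨max C D, fun u hu => hu.elim (fun h => (hC u h).trans (le_max_left _ _))
      fun h => (hD u h).trans (le_max_right _ _)⟩
  intro t ht
  have hL : ∃ C, ∀ᶠ u in nhdsWithin t (Ico 0 t), ‖f u‖ ≤ C := by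
    rcases ht.1.eq_or_lt with rfl | h0
    · exact ⟨0, by simp⟩
    obtain ⟨l, hl⟩ := hll t ⟨h0, ht.2⟩
    exact ⟨_, hl.norm.eventually_le_const (lt_add_one _)⟩
  have hR : ∃ C, ∀ᶠ u in nhdsWithin t (Icc t T), ‖f u‖ ≤ C := by
    rcases ht.2.eq_or_lt with rfl | h0
    · exact ⟨‖f t‖, by simp⟩
    exact ⟨_, (hrc t ⟨ht.1, h0⟩).norm.eventually_le_const (lt_add_one _)⟩
  obtain ⟨C, hC⟩ := hL
  obtain ⟨D, hD⟩ := hR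
  refine ⟨{u | ‖f u‖ ≤ max C D}, ?_, max C D, fun u hu => hu⟩
  rw [← Ico_union_Icc_eq_Icc ht.1 ht.2, nhdsWithin_union]
  exact ⟨hC.mono fun u h => h.trans (le_max_left _ _),
    hD.mono fun u h => h.trans (le_max_right _ _)⟩

/-- Left-endpoint Riemann averages of a càdlàg function converge to its integral. -/
theorem tendsto_integral_floor_grid {T : ℝ} (hT : 0 < T) {f : ℝ → ℝ}
    (hrc : ∀ t ∈ Ico (0 : ℝ) T, ContinuousWithinAt f (Icc t T) t)
    (hll : ∀ t ∈ Ioc (0 : ℝ) T, ∃ l : ℝ, Tendsto f (nhdsWithin t (Ico 0 t)) (nhds l)) :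
    Tendsto (fun n : ℕ => ∫ t in Icc (0 : ℝ) T, f ((⌊(n : ℝ) * t / T⌋ : ℝ) * T / n))
      atTop (nhds (∫ t in Icc (0 : ℝ) T, f t)) := by
  obtain ⟨C, hC⟩ := exists_bound_of_cadlag hrc hll
  refine tendsto_integral_of_dominated_convergence (fun _ => C) (fun n => ?_)
    (integrable_const C) (fun n => ?_) ?_
  · have h : Measurable fun k : ℤ => f ((k : ℝ) * T / n) := measurable_of_countable _
    exact (h.comp (Int.measurable_floor.comp (by fun_prop :
      Measurable fun t : ℝ => (n : ℝ) * t / T))).aestronglyMeasurable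
  · filter_upwards [ae_restrict_mem measurableSet_Icc] with t ht
    have h := floor_grid_mem_Icc hT ht.1 n
    exact hC _ ⟨h.1, h.2.trans ht.2⟩
  · filter_upwards [ae_restrict_mem measurableSet_Icc,
      ae_restrict_of_ae ((countable_not_tendsto_left hll).ae_notMem volume),
      ae_restrict_of_ae ((countable_singleton (0 : ℝ)).ae_notMem volume)] with t ht hlc ht0
    have h0 : 0 < t := lt_of_le_of_ne ht.1 (Ne.symm ht0)
    have hleft : Tendsto f (nhdsWithin t (Ico 0 t)) (nhds (f t)) := by
      by_contra h
      exact hlc ⟨⟨h0, ht.2⟩, h⟩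
    have hcw : ContinuousWithinAt f (Icc 0 t) t := by
      rw [← Ico_insert_right ht.1]
      exact ContinuousWithinAt.insert hleft
    exact hcw.tendsto.comp (tendsto_nhdsWithin_iff.2
      ⟨tendsto_floor_grid hT ht.1, Eventually.of_forall fun n => floor_grid_mem_Icc hT ht.1 n⟩)

/-- The time integral of the discretised process is a random variable. -/
theorem stronglyMeasurable_integral_floor_grid {Ω : Type*} [MeasurableSpace Ω] {T : ℝ}
    (hT : 0 < T) {S : ℝ → Ω → ℝ} (hS : ∀ t ∈ Icc (0 : ℝ) T, Measurable (S t)) (n : ℕ) :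
    StronglyMeasurable fun ω =>
      ∫ t in Icc (0 : ℝ) T, S ((⌊(n : ℝ) * t / T⌋ : ℝ) * T / n) ω := by
  classical
  let G : ℤ → Ω → ℝ := fun k ω =>
    if (k : ℝ) * T / n ∈ Icc (0 : ℝ) T then S ((k : ℝ) * T / n) ω else 0
  have hG : Measurable (fun p : ℤ × Ω => G p.1 p.2) := by
    refine measurable_from_prod_countable_right fun k => ?_
    by_cases hk : (k : ℝ) * T / n ∈ Icc (0 : ℝ) T
    · simpa only [G, if_pos hk] using hS _ hk
    · simp only [G, if_neg hk, measurable_const]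
  have hfloor : Measurable fun p : Ω × ℝ => (⌊(n : ℝ) * p.2 / T⌋, p.1) :=
    (Int.measurable_floor.comp (by fun_prop)).prodMk measurable_fst
  have h := ((hG.comp hfloor).stronglyMeasurable).integral_prod_right'
    (ν := volume.restrict (Icc (0 : ℝ) T))
  convert h using 2 with ω
  refine setIntegral_congr_fun measurableSet_Icc fun t ht => ?_
  have hmem := floor_grid_mem_Icc hT ht.1 n
  have hmem' : (⌊(n : ℝ) * t / T⌋ : ℝ) * T / n ∈ Icc (0 : ℝ) T := ⟨hmem.1, hmem.2.trans ht.2⟩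
  exact (if_pos hmem').symm

/-- For a càdlàg martingale `(S_t)_{t ∈ [0,T]}` and continuous
`F : ℝ → [0,∞)`, the discretised processes `S^n_t := S_{⌊nt/T⌋T/n}` satisfy:
(1) each `S^n` is a martingale with respect to `𝔊^n_t := 𝔉_{⌊nt/T⌋T/n}` with
`S^n_T = S_T`; (2) `A^n_T := ∫_0^T S^n_t dt → A_T := ∫_0^T S_t dt` a.s.;
(3) `E[F(A_T)] ≤ liminf_n E[F(A^n_T)]`. -/
theorem stmt_11 {Ω : Type*} {mΩ : MeasurableSpace Ω} {P : Measure Ω}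
    [IsProbabilityMeasure P] (T : ℝ) (hT : 0 < T)
    (ℱ : Filtration ℝ mΩ) (S : ℝ → Ω → ℝ)
    (hadapt : ∀ t ∈ Icc (0 : ℝ) T, StronglyMeasurable[ℱ t] (S t))
    (hint : ∀ t ∈ Icc (0 : ℝ) T, Integrable (S t) P)
    (hmart : ∀ s ∈ Icc (0 : ℝ) T, ∀ t ∈ Icc (0 : ℝ) T, s ≤ t →
      P[S t | ℱ s] =ᵐ[P] S s)
    -- càdlàg paths: right-continuity on [0,T) and left limits on (0,T]
    (hrc : ∀ ω, ∀ t ∈ Ico (0 : ℝ) T, ContinuousWithinAt (fun u => S u ω) (Icc t T) t)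
    (hll : ∀ ω, ∀ t ∈ Ioc (0 : ℝ) T, ∃ l : ℝ,
      Tendsto (fun u => S u ω) (nhdsWithin t (Ico 0 t)) (nhds l))
    (F : ℝ → ℝ) (hF : Continuous F) (hFnonneg : ∀ z, 0 ≤ F z) :
    -- (1) each Sⁿ is a 𝔊ⁿ-martingale with the same terminal value
    (∀ n : ℕ, 1 ≤ n →
      (∀ t ∈ Icc (0 : ℝ) T,
        StronglyMeasurable[ℱ ((⌊(n : ℝ) * t / T⌋ : ℝ) * T / n)]
          (S ((⌊(n : ℝ) * t / T⌋ : ℝ) * T / n))) ∧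
      (∀ t ∈ Icc (0 : ℝ) T, Integrable (S ((⌊(n : ℝ) * t / T⌋ : ℝ) * T / n)) P) ∧
      (∀ s ∈ Icc (0 : ℝ) T, ∀ t ∈ Icc (0 : ℝ) T, s ≤ t →
        P[S ((⌊(n : ℝ) * t / T⌋ : ℝ) * T / n) | ℱ ((⌊(n : ℝ) * s / T⌋ : ℝ) * T / n)]
          =ᵐ[P] S ((⌊(n : ℝ) * s / T⌋ : ℝ) * T / n)) ∧
      (∀ ω, S ((⌊(n : ℝ) * T / T⌋ : ℝ) * T / n) ω = S T ω)) ∧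
    -- (2) a.s. convergence of the discretised averages
    (∀ᵐ ω ∂P,
      Tendsto (fun n : ℕ => ∫ t in Icc (0 : ℝ) T, S ((⌊(n : ℝ) * t / T⌋ : ℝ) * T / n) ω)
        atTop (nhds (∫ t in Icc (0 : ℝ) T, S t ω))) ∧
    -- (3) Fatou bound for the payoff
    (∫⁻ ω, ENNReal.ofReal (F (∫ t in Icc (0 : ℝ) T, S t ω)) ∂P ≤
      Filter.liminf
        (fun n : ℕ =>
          ∫⁻ ω, ENNReal.ofReal
            (F (∫ t in Icc (0 : ℝ) T, S ((⌊(n : ℝ) * t / T⌋ : ℝ) * T / n) ω)) ∂P)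
        atTop) := by
  have hgrid (n : ℕ) {t : ℝ} (ht : t ∈ Icc (0 : ℝ) T) :
      (⌊(n : ℝ) * t / T⌋ : ℝ) * T / n ∈ Icc (0 : ℝ) T :=
    have h := floor_grid_mem_Icc hT ht.1 n
    ⟨h.1, h.2.trans ht.2⟩
  have hconv (ω : Ω) := tendsto_integral_floor_grid hT (hrc ω) (hll ω)
  refine ⟨fun n hn => ⟨fun t ht => hadapt _ (hgrid n ht), fun t ht => hint _ (hgrid n ht),
    fun s hs t ht hst => hmart _ (hgrid n hs) _ (hgrid n ht) (floor_grid_mono hT hst n),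
    fun ω => ?_⟩, Eventually.of_forall hconv, ?_⟩
  · have hn' : (n : ℝ) ≠ 0 := by exact_mod_cast (by omega : n ≠ 0)
    rw [mul_div_cancel_right₀ _ hT.ne', Int.floor_natCast, Int.cast_natCast,
      mul_div_cancel_left₀ _ hn']
  · have hS (t : ℝ) (ht : t ∈ Icc (0 : ℝ) T) : Measurable (S t) :=
      ((hadapt t ht).mono (ℱ.le t)).measurable
    refine le_of_eq_of_le (lintegral_congr fun ω => ?_) (lintegral_liminf_le fun n =>
      (hF.measurable.comp
        (stronglyMeasurable_integral_floor_grid hT hS n).measurable).ennreal_ofReal)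
    exact (ENNReal.tendsto_ofReal ((hF.tendsto _).comp (hconv ω))).liminf_eq.symm
end

section
/- Fix T > 0 and real numbers K₁ ∈ (−1,1), K₂ ∈ (0,1) with K₁ < K₂. For t ∈ [0,T), a ∈ ℝ, and (β,γ) with β ≥ 0, γ ≥ 0, 0 < β + γ ≤ 1, set a⁻¹ := a − (T−t), a⁰ := a, a¹ := a + (T−t), a⁰¹ := a + (γ/(γ+β))(T−t), a⁻¹⁰¹ := a + (2γ+β−1)(T−t), and define V(t,a;β,γ) := K₂ − K₁ if K₂ ≤ a⁻¹⁰¹; := (2γ+β−1)(T−t) + a − K₁ if K₁ ≤ a⁻¹ and a⁻¹⁰¹ < K₂; := (2γ+β)(K₂−K₁)/(1 + (K₂−a)/(T−t)) if a⁻¹ < K₁ and a⁻¹⁰¹ < K₂ ≤ a⁰¹; := γ(T−t) − (γ+β)(K₁−a) if a⁻¹ < K₁ ≤ a⁰ and a⁰¹ < K₂; := γ(T−t)(K₂−K₁)/(K₂−a) if a⁰ < K₁ and a⁰¹ < K₂ ≤ a¹; := γ(T−t−(K₁−a)) if a⁰ < K₁ ≤ a¹ < K₂; := 0 if a¹ <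 K₁. Then V is a continuous function on the domain {(t,a,β,γ) : t ∈ [0,T), a ∈ ℝ, β ≥ 0, γ ≥ 0, 0 < β + γ ≤ 1}. -/
open Set

/-- The candidate value function `V(t,a;β,γ)` from the non-convex example, for the payoff
`F(A) = (A−K₁)₊ − (A−K₂)₊` and terminal law `μ = (1−β−γ)δ₋₁ + βδ₀ + γδ₁`.
The seven regions (i)–(vii) of the paper are encoded by this if-then-else chain, which
agrees with the region description since `a⁻¹ ≤ a⁰ ≤ a¹`, `a⁻¹⁰¹ ≤ a⁰¹ ≤ a¹` on the
domain `β, γ ≥ 0`, `0 < β + γ ≤ 1`, `t < T`. -/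
noncomputable def asianV (T K₁ K₂ t a β γ : ℝ) : ℝ :=
  if K₂ ≤ a + (2 * γ + β - 1) * (T - t) then K₂ - K₁                       -- (i)
  else if K₁ ≤ a - (T - t) then (2 * γ + β - 1) * (T - t) + a - K₁         -- (ii)
  else if K₂ ≤ a + (γ / (γ + β)) * (T - t) then
    (2 * γ + β) * (K₂ - K₁) / (1 + (K₂ - a) / (T - t))                     -- (iii)
  else if K₁ ≤ a then γ * (T - t) - (γ + β) * (K₁ - a)                     -- (iv)
  else if K₂ ≤ a + (T - t) then γ * (T - t) * (K₂ - K₁) / (K₂ - a)         -- (v)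
  else if K₁ ≤ a + (T - t) then γ * (T - t - (K₁ - a))                     -- (vi)
  else 0                                                                    -- (vii)

theorem ContinuousOn.ite_le {X : Type*} [TopologicalSpace X] {S : Set X} {u v f g : X → ℝ}
    (hu : ContinuousOn u S) (hv : ContinuousOn v S)
    (hf : ContinuousOn f (S ∩ {x | u x ≤ v x})) (hg : ContinuousOn g (S ∩ {x | v x ≤ u x}))
    (hfg : ∀ x ∈ S, u x = v x → f x = g x) :
    ContinuousOn (fun x => if u x ≤ v x then f x else g x) S := by
  rw [continuousOn_iff_continuous_domRestrict] at hu hv ⊢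
  refine continuous_if_le hu hv ?_ ?_ fun x hx => hfg x x.2 hx
  · exact hf.comp continuous_subtype_val.continuousOn fun x hx => ⟨x.2, hx⟩
  · exact hg.comp continuous_subtype_val.continuousOn fun x hx => ⟨x.2, hx⟩

/-- The conditional mean over `{-1, 0, 1}` is at most the conditional mean over `{0, 1}`. -/
theorem mean_le_condMean {β γ : ℝ} (hγ : 0 ≤ γ) (h0 : 0 < β + γ) (h1 : β + γ ≤ 1) :
    2 * γ + β - 1 ≤ γ / (γ + β) := by
  rw [le_div_iff₀ (by linarith)]
  nlinarith

/-- The candidate value function `V(t,a;β,γ)` of the non-convex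
example is continuous on the domain
`{t ∈ [0,T), a ∈ ℝ, β ≥ 0, γ ≥ 0, 0 < β + γ ≤ 1}`. -/
theorem stmt_12 (T K₁ K₂ : ℝ) (hT : 0 < T)
    (hK₁ : K₁ ∈ Ioo (-1 : ℝ) 1) (hK₂ : K₂ ∈ Ioo (0 : ℝ) 1) (hK : K₁ < K₂) :
    ContinuousOn
      (fun p : ℝ × ℝ × ℝ × ℝ => asianV T K₁ K₂ p.1 p.2.1 p.2.2.1 p.2.2.2)
      {p : ℝ × ℝ × ℝ × ℝ | p.1 ∈ Ico (0 : ℝ) T ∧ 0 ≤ p.2.2.1 ∧ 0 ≤ p.2.2.2 ∧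
        0 < p.2.2.1 + p.2.2.2 ∧ p.2.2.1 + p.2.2.2 ≤ 1} := by
  unfold asianV
  have hr : ContinuousOn (fun p : ℝ × ℝ × ℝ × ℝ => p.2.2.2 / (p.2.2.2 + p.2.2.1))
      {p : ℝ × ℝ × ℝ × ℝ | p.1 ∈ Ico (0 : ℝ) T ∧ 0 ≤ p.2.2.1 ∧ 0 ≤ p.2.2.2 ∧
        0 < p.2.2.1 + p.2.2.2 ∧ p.2.2.1 + p.2.2.2 ≤ 1} := by
    refine ContinuousOn.div (by fun_prop) (by fun_prop) ?_
    rintro ⟨t, a, β, γ⟩ ⟨-, -, -, h0, -⟩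
    dsimp only at h0 ⊢
    linarith
  refine ContinuousOn.ite_le (by fun_prop) (by fun_prop) (by fun_prop) ?_ ?_
  · refine ContinuousOn.ite_le (by fun_prop) (by fun_prop) (by fun_prop) ?_ ?_
    · refine ContinuousOn.ite_le (by fun_prop) ?_ ?_ ?_ ?_
      · have := hr.mono (inter_subset_left.trans inter_subset_left :
          _ ∩ {p : ℝ × ℝ × ℝ × ℝ | p.2.1 + (2 * p.2.2.2 + p.2.2.1 - 1) * (T - p.1) ≤ K₂} ∩
            {p : ℝ × ℝ × ℝ × ℝ | p.2.1 - (T - p.1) ≤ K₁} ⊆ _)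
        fun_prop
      · have hs : ∀ p : ℝ × ℝ × ℝ × ℝ, p.1 ∈ Ico 0 T → T - p.1 ≠ 0 :=
          fun p hp => (sub_pos.2 hp.2).ne'
        refine ContinuousOn.div (by fun_prop)
          (continuousOn_const.add (ContinuousOn.div (by fun_prop) (by fun_prop) ?_)) ?_
        · rintro p ⟨⟨⟨⟨hp, -⟩, -⟩, -⟩, -⟩
          exact hs p hp
        · rintro ⟨t, a, β, γ⟩ ⟨⟨⟨⟨⟨-, ht⟩, -⟩, -⟩, h⟩, -⟩
          dsimp only [mem_ofPred_eq] at *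
          have hs : 0 < T - t := sub_pos.2 ht
          rw [one_add_div hs.ne']
          exact (div_pos (by linarith) hs).ne'
      · refine ContinuousOn.ite_le (by fun_prop) (by fun_prop) (by fun_prop) ?_ ?_
        · refine ContinuousOn.ite_le (by fun_prop) (by fun_prop) ?_ ?_ ?_
          · refine ContinuousOn.div (by fun_prop) (by fun_prop) ?_
            rintro ⟨t, a, β, γ⟩ ⟨⟨-, h⟩, -⟩
            dsimp only [mem_ofPred_eq] at *
            linarith
          · refine ContinuousOn.ite_le (by fun_prop) (by fun_prop) (by fun_prop) (by fun_prop) ?_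
            rintro ⟨t, a, β, γ⟩ - h
            dsimp only at *
            rw [h]
            ring
          · rintro ⟨t, a, β, γ⟩ ⟨-, h⟩ h'
            dsimp only [mem_ofPred_eq] at *
            rw [if_pos (by linarith), div_eq_iff (by linarith)]
            rw [h']
            ring
        · rintro ⟨t, a, β, γ⟩ ⟨⟨⟨⟨⟨-, ht⟩, -⟩, -⟩, -⟩, -⟩ h
          dsimp only [mem_ofPred_eq] at *
          subst h
          have : K₂ - K₁ ≠ 0 := by linarith
          split_ifs
          · field_simp
            ring
          · ring
          · linarith
      · rintro ⟨t, a, β, γ⟩ ⟨⟨⟨⟨-, ht⟩, hβ, hγ, h0, h1⟩, -⟩, h⟩ h'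
        dsimp only [mem_ofPred_eq] at *
        have hs : 0 < T - t := sub_pos.2 ht
        have hr0 : 0 ≤ γ / (γ + β) := div_nonneg hγ (by linarith)
        have hr1 : γ / (γ + β) ≤ 1 := div_le_one_of_le₀ (by linarith) (by linarith)
        have hrm : γ = γ / (γ + β) * (γ + β) := (div_mul_cancel₀ _ (by linarith)).symm
        generalize γ / (γ + β) = r at *
        have e : (K₂ - a) / (T - t) = r := by
          rw [div_eq_iff hs.ne']
          linarith
        have e' : (2 * γ + β) * (K₂ - K₁) / (1 + r) = (γ + β) * (K₂ - K₁) := by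
          rw [div_eq_iff (by linarith)]
          linear_combination (K₂ - K₁) * hrm
        rw [e, e']
        split_ifs with c1 c2 c3
        · linear_combination (γ + β) * h' - (T - t) * hrm
        · rw [eq_div_iff (by linarith)]
          linear_combination (K₂ - K₁) * ((γ + β) * h' - (T - t) * hrm)
        · nlinarith
        · nlinarith
    · rintro ⟨t, a, β, γ⟩ ⟨⟨⟨-, ht⟩, hβ, hγ, h0, h1⟩, -⟩ h
      dsimp only [mem_ofPred_eq] at *
      have hs : 0 < T - t := sub_pos.2 ht
      rw [if_pos (show K₁ ≤ a by linarith)]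
      subst h
      split_ifs
      · rw [one_add_div hs.ne', eq_div_iff (div_pos (by linarith) hs).ne']
        field_simp
        ring
      · ring
  · rintro ⟨t, a, β, γ⟩ ⟨⟨-, ht⟩, hβ, hγ, h0, h1⟩ h
    dsimp only at *
    have hs : 0 < T - t := sub_pos.2 ht
    have hm := mul_le_mul_of_nonneg_right (mean_le_condMean hγ h0 h1) hs.le
    rw [if_pos (show K₂ ≤ a + γ / (γ + β) * (T - t) by linarith)]
    have e : (K₂ - a) / (T - t) = 2 * γ + β - 1 := by
      rw [div_eq_iff hs.ne']
      linarith
    rw [e]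
    split_ifs
    · linarith
    · rw [eq_div_iff (by linarith)]
      ring
end

section
/- Fix T > 0 and real numbers K₁ ∈ (−1,1), K₂ ∈ (0,1) with K₁ < K₂, and let V(t,a;β,γ) be the piecewise-defined function from the non-convex example (with the seven regions (i)–(vii) determined by the inequalities among K₁, K₂ and a⁻¹, a⁰, a¹, a⁰¹, a⁻¹⁰¹). Then for each fixed t ∈ [0,T) and a ∈ ℝ, the map (β,γ) ↦ V(t,a;β,γ) is concave on the simplex {(β,γ) : β ≥ 0, γ ≥ 0, 0 < β + γ ≤ 1}. -/
open Set

/-- The domain of the pair `(β, γ)` is convex. -/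
theorem convex_simplex_punctured :
    Convex ℝ {q : ℝ × ℝ | 0 ≤ q.1 ∧ 0 ≤ q.2 ∧ 0 < q.1 + q.2 ∧ q.1 + q.2 ≤ 1} := by
  rintro ⟨x₁, x₂⟩ ⟨hx₁, hx₂, hx, hx'⟩ ⟨y₁, y₂⟩ ⟨hy₁, hy₂, hy, hy'⟩ u v hu hv huv
  simp only [Prod.smul_mk, Prod.mk_add_mk, smul_eq_mul, mem_ofPred_eq] at *
  refine ⟨by positivity, by positivity, ?_, by nlinarith⟩
  rcases hu.eq_or_lt with rfl | hu
  · obtain rfl : v = 1 := by linarith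
    linarith
  · nlinarith [mul_pos hu hx, mul_nonneg hv hy.le]

/-- An affine function of two real variables is concave on every convex set. -/
theorem concaveOn_affine_prod {S : Set (ℝ × ℝ)} (hS : Convex ℝ S) (c u v : ℝ) :
    ConcaveOn ℝ S (fun q : ℝ × ℝ => c + u * q.1 + v * q.2) := by
  refine ⟨hS, fun x _ y _ m n _ _ hmn => le_of_eq ?_⟩
  simp only [Prod.fst_add, Prod.snd_add, Prod.smul_fst, Prod.smul_snd, smul_eq_mul]
  linear_combination c * hmn

/-- A nested conditional that always selects the smallest of three values. -/
theorem ite_ite_eq_min {P Q : Prop} [Decidable P] [Decidable Q] {f g h : ℝ}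
    (hP : P ↔ f ≤ g) (hQ : Q ↔ g ≤ h) (hPQ : P → Q) :
    (if P then f else if Q then g else h) = min f (min g h) := by
  split_ifs with h₁ h₂
  · rw [min_eq_left (hQ.1 (hPQ h₁)), min_eq_left (hP.1 h₁)]
  · rw [min_eq_left (hQ.1 h₂), min_eq_right (not_le.1 (mt hP.2 h₁)).le]
  · have hgf := not_le.1 (mt hP.2 h₁)
    have hhg := not_le.1 (mt hQ.2 h₂)
    rw [min_eq_right hhg.le, min_eq_right (hhg.trans hgf).le]

section Regions

variable {T K₁ K₂ t a β γ : ℝ}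

theorem region_cap_iff (hs : 0 < T - t) (hK : K₁ < K₂) (h : a - (T - t) < K₁) :
    K₂ ≤ a + (2 * γ + β - 1) * (T - t) ↔
      K₂ - K₁ ≤ (2 * γ + β) * (K₂ - K₁) / (1 + (K₂ - a) / (T - t)) := by
  have hd : 0 < T - t + (K₂ - a) := by linarith
  have e : 1 + (K₂ - a) / (T - t) = (T - t + (K₂ - a)) / (T - t) := by field_simp
  rw [e, le_div_iff₀ (div_pos hd hs), mul_comm (K₂ - K₁), mul_le_mul_iff_left₀ (sub_pos.2 hK),
    div_le_iff₀ hs]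
  constructor <;> intro h <;> linarith

theorem region_ratio_iff (hp : 0 < β + γ) :
    K₂ ≤ a + γ / (γ + β) * (T - t) ↔ (γ + β) * (K₂ - a) ≤ γ * (T - t) := by
  have hp' : 0 < γ + β := by linarith
  rw [← sub_le_iff_le_add', div_mul_eq_mul_div, le_div_iff₀ hp', mul_comm]

theorem region_cap_imp (hs : 0 < T - t) (hβ : 0 ≤ β) (hγ : 0 ≤ γ) (hp : 0 < β + γ)
    (hp1 : β + γ ≤ 1) (h : K₂ ≤ a + (2 * γ + β - 1) * (T - t)) :
    K₂ ≤ a + γ / (γ + β) * (T - t) := by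
  rw [region_ratio_iff hp]
  have h₁ : (γ + β) * (2 * γ + β - 1) ≤ γ := by nlinarith
  nlinarith [mul_le_mul_of_nonneg_right h₁ hs.le,
    mul_le_mul_of_nonneg_left (sub_le_iff_le_add'.2 h) (by linarith : 0 ≤ γ + β)]

/-- When `K₁` is certain to be reached, `V` is the minimum of two affine functions. -/
theorem asianV_eq_min_of_le (h : K₁ ≤ a - (T - t)) :
    asianV T K₁ K₂ t a β γ = min (K₂ - K₁) ((2 * γ + β - 1) * (T - t) + a - K₁) := by
  unfold asianV
  rw [if_pos h]
  split_ifs with h₁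
  · rw [min_eq_left]; linarith
  · rw [min_eq_right]; linarith

theorem asianV_eq_min_of_lower (hs : 0 < T - t) (hK : K₁ < K₂) (hβ : 0 ≤ β) (hγ : 0 ≤ γ)
    (hp : 0 < β + γ) (hp1 : β + γ ≤ 1) (h : a - (T - t) < K₁) (h₀ : K₁ ≤ a) :
    asianV T K₁ K₂ t a β γ =
      min (K₂ - K₁) (min ((2 * γ + β) * (K₂ - K₁) / (1 + (K₂ - a) / (T - t)))
        (γ * (T - t) - (γ + β) * (K₁ - a))) := by
  unfold asianV
  rw [if_neg h.not_ge, if_pos h₀]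
  refine ite_ite_eq_min (region_cap_iff hs hK h) ?_ (region_cap_imp hs hβ hγ hp hp1)
  rw [region_ratio_iff hp]
  have hd : 0 < T - t + (K₂ - a) := by linarith
  have hx : 0 < T - t + (K₁ - a) := by linarith
  have e : γ * (T - t) - (γ + β) * (K₁ - a)
      - (2 * γ + β) * (K₂ - K₁) / (1 + (K₂ - a) / (T - t))
      = (T - t + (K₁ - a)) / (T - t + (K₂ - a))
        * (γ * (T - t) - (γ + β) * (K₂ - a)) := by
    have e' : 1 + (K₂ - a) / (T - t) = (T - t + (K₂ - a)) / (T - t) := by field_simp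
    rw [e']
    field_simp
    ring
  rw [← sub_nonneg, ← sub_nonneg (b := (2 * γ + β) * _ / _), e,
    mul_nonneg_iff_of_pos_left (div_pos hx hd)]

theorem asianV_eq_min_of_upper (hs : 0 < T - t) (hK : K₁ < K₂) (hβ : 0 ≤ β) (hγ : 0 ≤ γ)
    (hp : 0 < β + γ) (hp1 : β + γ ≤ 1) (h₀ : a < K₁) (h₁ : K₂ ≤ a + (T - t)) :
    asianV T K₁ K₂ t a β γ =
      min (K₂ - K₁) (min ((2 * γ + β) * (K₂ - K₁) / (1 + (K₂ - a) / (T - t)))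
        (γ * (T - t) * (K₂ - K₁) / (K₂ - a))) := by
  have h : a - (T - t) < K₁ := by linarith
  unfold asianV
  rw [if_neg h.not_ge, if_neg h₀.not_ge, if_pos h₁]
  refine ite_ite_eq_min (region_cap_iff hs hK h) ?_ (region_cap_imp hs hβ hγ hp hp1)
  rw [region_ratio_iff hp]
  have hy : 0 < K₂ - a := by linarith
  have hd : 0 < T - t + (K₂ - a) := by linarith
  have e : γ * (T - t) * (K₂ - K₁) / (K₂ - a)
      - (2 * γ + β) * (K₂ - K₁) / (1 + (K₂ - a) / (T - t))
      = (T - t) * (K₂ - K₁) / ((K₂ - a) * (T - t + (K₂ - a)))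
        * (γ * (T - t) - (γ + β) * (K₂ - a)) := by
    have e' : 1 + (K₂ - a) / (T - t) = (T - t + (K₂ - a)) / (T - t) := by field_simp
    rw [e']
    field_simp
    ring
  rw [← sub_nonneg, ← sub_nonneg (b := (2 * γ + β) * _ / _), e,
    mul_nonneg_iff_of_pos_left (div_pos (mul_pos hs (sub_pos.2 hK)) (mul_pos hy hd))]

/-- When `K₂` is out of reach and `K₁` is not yet reached, `V` is linear. -/
theorem asianV_eq_of_gt (hs : 0 < T - t) (hβ : 0 ≤ β) (hγ : 0 ≤ γ)
    (hp : 0 < β + γ) (hp1 : β + γ ≤ 1) (h₀ : a < K₁) (h₁ : a + (T - t) < K₂) :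
    asianV T K₁ K₂ t a β γ = γ * max (T - t - (K₁ - a)) 0 := by
  have hr : ¬ K₂ ≤ a + γ / (γ + β) * (T - t) := by
    rw [region_ratio_iff hp]
    nlinarith [mul_nonneg hβ hs.le]
  have hc := mt (region_cap_imp hs hβ hγ hp hp1) hr
  unfold asianV
  rw [if_neg hc, if_neg (by linarith : ¬ K₁ ≤ a - (T - t)), if_neg hr, if_neg h₀.not_ge,
    if_neg h₁.not_ge]
  split_ifs with h₂
  · rw [max_eq_left (by linarith)]
  · rw [max_eq_right (by linarith), mul_zero]

end Regions

/-- For each fixed `t ∈ [0,T)` and `a ∈ ℝ`, the map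
`(β,γ) ↦ V(t,a;β,γ)` is concave on the simplex
`{(β,γ) : β ≥ 0, γ ≥ 0, 0 < β + γ ≤ 1}`. -/
theorem stmt_13 (T K₁ K₂ : ℝ) (hT : 0 < T)
    (hK₁ : K₁ ∈ Ioo (-1 : ℝ) 1) (hK₂ : K₂ ∈ Ioo (0 : ℝ) 1) (hK : K₁ < K₂)
    (t a : ℝ) (ht : t ∈ Ico (0 : ℝ) T) :
    ConcaveOn ℝ
      {q : ℝ × ℝ | 0 ≤ q.1 ∧ 0 ≤ q.2 ∧ 0 < q.1 + q.2 ∧ q.1 + q.2 ≤ 1}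
      (fun q : ℝ × ℝ => asianV T K₁ K₂ t a q.1 q.2) := by
  have hs : 0 < T - t := sub_pos.2 ht.2
  have aff := concaveOn_affine_prod convex_simplex_punctured
  rcases le_or_gt K₁ (a - (T - t)) with h | h
  · refine ((aff (K₂ - K₁) 0 0).inf (aff (a - K₁ - (T - t)) (T - t) (2 * (T - t)))).congr ?_
    rintro ⟨β, γ⟩ -
    simp only [asianV_eq_min_of_le h, Pi.inf_apply]
    congr 1 <;> ring
  have cap := aff (K₂ - K₁) 0 0
  have mid := aff 0 ((K₂ - K₁) / (1 + (K₂ - a) / (T - t)))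
    (2 * (K₂ - K₁) / (1 + (K₂ - a) / (T - t)))
  rcases le_or_gt K₁ a with h₀ | h₀
  · refine (cap.inf (mid.inf (aff 0 (-(K₁ - a)) (T - t - (K₁ - a))))).congr ?_
    rintro ⟨β, γ⟩ ⟨hβ, hγ, hp, hp1⟩
    simp only [asianV_eq_min_of_lower hs hK hβ hγ hp hp1 h h₀, Pi.inf_apply]
    congr 1
    · ring
    · congr 1 <;> ring
  rcases le_or_gt K₂ (a + (T - t)) with h₁ | h₁
  · refine (cap.inf (mid.inf (aff 0 0 ((T - t) * (K₂ - K₁) / (K₂ - a))))).congr ?_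
    rintro ⟨β, γ⟩ ⟨hβ, hγ, hp, hp1⟩
    simp only [asianV_eq_min_of_upper hs hK hβ hγ hp hp1 h₀ h₁, Pi.inf_apply]
    congr 1
    · ring
    · congr 1 <;> ring
  · refine (aff 0 0 (max (T - t - (K₁ - a)) 0)).congr ?_
    rintro ⟨β, γ⟩ ⟨hβ, hγ, hp, hp1⟩
    simp only [asianV_eq_of_gt hs hβ hγ hp hp1 h₀ h₁]
    ring
end

section
/- Fix T > 0 and real numbers K₁ ∈ (−1,1), K₂ ∈ (0,1) with K₁ < K₂, and let V(t,a;β,γ) be the piecewise-defined function from the non-convex example with seven regions (i)–(vii). Write s := 2γ + β − 1. Then at every point (t,a,β,γ) with t ∈ [0,T), a ∈ ℝ, β ≥ 0, γ ≥ 0, 0 < β + γ ≤ 1 lying in the interior of one of the regions (i)–(vii), V is differentiable in (t,a) and satisfies ∂V/∂t + s · ∂V/∂a ≤ 0, with equality in regions (i), (ii) and (vii); in particular, in region (iii) one has ∂V/∂t + s ∂V/∂a = (K₂−K₁)(2γ+β)/(1 + (K₂−a)/(T−t))² · ( −(K₂−a)/(T−t)² + (2γ+β−1)/(T−t) ), in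 region (iv) it equals −γ + (2γ+β−1)(γ+β), in region (v) it equals −γ(K₂−K₁)/(K₂−a)² · ( K₂ − a − (2γ+β−1)(T−t) ), and in region (vi) it equals 2γ(γ + β/2 − 1). -/
open Set

/-- If `f` agrees near `x` with a differentiable function `g` whose derivative along the line
`r ↦ x + r • v` at `r = 0` is `c`, then `f` is differentiable at `x` and `fderiv ℝ f x v = c`. -/
theorem differentiableAt_and_fderiv_apply_eq_of_eventuallyEq {E : Type*} [NormedAddCommGroup E]
    [NormedSpace ℝ E] {f g : E → ℝ} {x v : E} {c : ℝ} (hfg : f =ᶠ[nhds x] g)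
    (hg : DifferentiableAt ℝ g x) (hc : HasDerivAt (fun r : ℝ => g (x + r • v)) c 0) :
    DifferentiableAt ℝ f x ∧ fderiv ℝ f x v = c := by
  refine ⟨hg.congr_of_eventuallyEq hfg, ?_⟩
  rw [hfg.fderiv_eq, ← hg.lineDeriv_eq_fderiv]
  exact HasLineDerivAt.lineDeriv hc

theorem differentiableAt_and_fderiv_apply_nonpos_of_eventuallyEq {E : Type*}
    [NormedAddCommGroup E] [NormedSpace ℝ E] {f g : E → ℝ} {x v : E} {c : ℝ}
    (hfg : f =ᶠ[nhds x] g) (hg : DifferentiableAt ℝ g x)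
    (hc : HasDerivAt (fun r : ℝ => g (x + r • v)) c 0) (hc0 : c ≤ 0) :
    DifferentiableAt ℝ f x ∧ fderiv ℝ f x v = c ∧ fderiv ℝ f x v ≤ 0 :=
  have h := differentiableAt_and_fderiv_apply_eq_of_eventuallyEq hfg hg hc
  ⟨h.1, h.2, h.2.trans_le hc0⟩

theorem Continuous.eventually_lt_nhds {X : Type*} [TopologicalSpace X] {f g : X → ℝ} {x : X}
    (hf : Continuous f) (hg : Continuous g) (h : f x < g x) : ∀ᶠ y in nhds x, f y < g y :=
  hf.continuousAt.eventually_lt hg.continuousAt h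

theorem two_mul_add_sub_one_le_div_add {β γ : ℝ} (hβ : 0 ≤ β) (hγ : 0 ≤ γ) (hpos : 0 < β + γ)
    (hle : β + γ ≤ 1) : 2 * γ + β - 1 ≤ γ / (γ + β) := by
  rw [le_div_iff₀ (by linarith)]
  nlinarith

theorem div_add_self_le_one {β γ : ℝ} (hβ : 0 ≤ β) (hpos : 0 < β + γ) : γ / (γ + β) ≤ 1 := by
  rw [div_le_one (by linarith)]
  linarith

/-- At every point in the interior of one of the seven regions
(i)–(vii), the map `(t,a) ↦ V(t,a;β,γ)` is differentiable and the drift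
`∂V/∂t + s ∂V/∂a` (the derivative in the direction `(1,s)`, `s = 2γ + β − 1`) is `≤ 0`,
with equality in regions (i), (ii), (vii), and with the explicit values stated for
regions (iii)–(vi). -/
theorem stmt_14 (T K₁ K₂ : ℝ) (hT : 0 < T)
    (hK₁ : K₁ ∈ Ioo (-1 : ℝ) 1) (hK₂ : K₂ ∈ Ioo (0 : ℝ) 1) (hK : K₁ < K₂)
    (t a β γ : ℝ) (ht : t ∈ Ico (0 : ℝ) T)
    (hβ : 0 ≤ β) (hγ : 0 ≤ γ) (hβγpos : 0 < β + γ) (hβγle : β + γ ≤ 1) :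
    -- region (i): K₂ < a⁻¹⁰¹
    (K₂ < a + (2 * γ + β - 1) * (T - t) →
      DifferentiableAt ℝ (fun p : ℝ × ℝ => asianV T K₁ K₂ p.1 p.2 β γ) (t, a) ∧
      fderiv ℝ (fun p : ℝ × ℝ => asianV T K₁ K₂ p.1 p.2 β γ) (t, a)
        (1, 2 * γ + β - 1) = 0) ∧
    -- region (ii): K₁ < a⁻¹ and a⁻¹⁰¹ < K₂
    (K₁ < a - (T - t) → a + (2 * γ + β - 1) * (T - t) < K₂ →
      DifferentiableAt ℝ (fun p : ℝ × ℝ => asianV T K₁ K₂ p.1 p.2 β γ) (t, a) ∧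
      fderiv ℝ (fun p : ℝ × ℝ => asianV T K₁ K₂ p.1 p.2 β γ) (t, a)
        (1, 2 * γ + β - 1) = 0) ∧
    -- region (iii): a⁻¹ < K₁ and a⁻¹⁰¹ < K₂ < a⁰¹
    (a - (T - t) < K₁ → a + (2 * γ + β - 1) * (T - t) < K₂ →
        K₂ < a + (γ / (γ + β)) * (T - t) →
      DifferentiableAt ℝ (fun p : ℝ × ℝ => asianV T K₁ K₂ p.1 p.2 β γ) (t, a) ∧
      fderiv ℝ (fun p : ℝ × ℝ => asianV T K₁ K₂ p.1 p.2 β γ) (t, a)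
          (1, 2 * γ + β - 1)
        = (K₂ - K₁) * (2 * γ + β) / (1 + (K₂ - a) / (T - t)) ^ 2 *
            (-(K₂ - a) / (T - t) ^ 2 + (2 * γ + β - 1) / (T - t)) ∧
      fderiv ℝ (fun p : ℝ × ℝ => asianV T K₁ K₂ p.1 p.2 β γ) (t, a)
        (1, 2 * γ + β - 1) ≤ 0) ∧
    -- region (iv): a⁻¹ < K₁ < a⁰ and a⁰¹ < K₂
    (a - (T - t) < K₁ → K₁ < a → a + (γ / (γ + β)) * (T - t) < K₂ →
      DifferentiableAt ℝ (fun p : ℝ × ℝ => asianV T K₁ K₂ p.1 p.2 β γ) (t, a) ∧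
      fderiv ℝ (fun p : ℝ × ℝ => asianV T K₁ K₂ p.1 p.2 β γ) (t, a)
          (1, 2 * γ + β - 1)
        = -γ + (2 * γ + β - 1) * (γ + β) ∧
      fderiv ℝ (fun p : ℝ × ℝ => asianV T K₁ K₂ p.1 p.2 β γ) (t, a)
        (1, 2 * γ + β - 1) ≤ 0) ∧
    -- region (v): a⁰ < K₁ and a⁰¹ < K₂ < a¹
    (a < K₁ → a + (γ / (γ + β)) * (T - t) < K₂ → K₂ < a + (T - t) →
      DifferentiableAt ℝ (fun p : ℝ × ℝ => asianV T K₁ K₂ p.1 p.2 β γ) (t, a) ∧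
      fderiv ℝ (fun p : ℝ × ℝ => asianV T K₁ K₂ p.1 p.2 β γ) (t, a)
          (1, 2 * γ + β - 1)
        = -γ * (K₂ - K₁) / (K₂ - a) ^ 2 *
            (K₂ - a - (2 * γ + β - 1) * (T - t)) ∧
      fderiv ℝ (fun p : ℝ × ℝ => asianV T K₁ K₂ p.1 p.2 β γ) (t, a)
        (1, 2 * γ + β - 1) ≤ 0) ∧
    -- region (vi): a⁰ < K₁ < a¹ < K₂
    (a < K₁ → K₁ < a + (T - t) → a + (T - t) < K₂ →
      DifferentiableAt ℝ (fun p : ℝ × ℝ => asianV T K₁ K₂ p.1 p.2 β γ) (t, a) ∧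
      fderiv ℝ (fun p : ℝ × ℝ => asianV T K₁ K₂ p.1 p.2 β γ) (t, a)
          (1, 2 * γ + β - 1)
        = 2 * γ * (γ + β / 2 - 1) ∧
      fderiv ℝ (fun p : ℝ × ℝ => asianV T K₁ K₂ p.1 p.2 β γ) (t, a)
        (1, 2 * γ + β - 1) ≤ 0) ∧
    -- region (vii): a¹ < K₁
    (a + (T - t) < K₁ →
      DifferentiableAt ℝ (fun p : ℝ × ℝ => asianV T K₁ K₂ p.1 p.2 β γ) (t, a) ∧
      fderiv ℝ (fun p : ℝ × ℝ => asianV T K₁ K₂ p.1 p.2 β γ) (t, a)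
        (1, 2 * γ + β - 1) = 0) := by
  obtain ⟨-, htT⟩ := ht
  have hτ : 0 < T - t := sub_pos.mpr htT
  have hsq := two_mul_add_sub_one_le_div_add hβ hγ hβγpos hβγle
  have hq1 := div_add_self_le_one (γ := γ) hβ hβγpos
  have hs1 : 2 * γ + β - 1 ≤ 1 := hsq.trans hq1
  set s := 2 * γ + β - 1 with hs
  set q := γ / (γ + β) with hq
  have hnear : ∀ᶠ p : ℝ × ℝ in nhds (t, a), 0 < T - p.1 ∧
      s * (T - p.1) ≤ q * (T - p.1) ∧ q * (T - p.1) ≤ T - p.1 := by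
    filter_upwards [Continuous.eventually_lt_nhds (x := (t, a)) (f := fun _ : ℝ × ℝ => (0 : ℝ))
      (g := fun p => T - p.1) (by fun_prop) (by fun_prop) hτ] with p hp
    exact ⟨hp, mul_le_mul_of_nonneg_right hsq hp.le, mul_le_of_le_one_left hp.le hq1⟩
  have hline_t : HasDerivAt (fun r : ℝ => T - (t + r * 1)) (-1) 0 := by
    simpa using (((hasDerivAt_id (0 : ℝ)).mul_const 1).const_add t).const_sub T
  have hline_a : HasDerivAt (fun r : ℝ => a + r * s) s 0 := by
    simpa using ((hasDerivAt_id (0 : ℝ)).mul_const s).const_add a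
  refine ⟨?_, ?_, ?_, ?_, ?_, ?_, ?_⟩
  · intro h
    have e1 : ∀ᶠ p : ℝ × ℝ in nhds (t, a), K₂ < p.2 + s * (T - p.1) :=
      Continuous.eventually_lt_nhds (by fun_prop) (by fun_prop) h
    have heq : (fun p : ℝ × ℝ => asianV T K₁ K₂ p.1 p.2 β γ) =ᶠ[nhds (t, a)]
        fun p => K₂ - K₁ := by
      filter_upwards [hnear, e1] with p ⟨hτp, hsp, hqp⟩ h1
      simp only [asianV, ← hs, ← hq]
      rw [if_pos (by linarith)]
    refine differentiableAt_and_fderiv_apply_eq_of_eventuallyEq heq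
      (by fun_prop) ?_
    exact hasDerivAt_const _ _
  · intro ha hb
    have e1 : ∀ᶠ p : ℝ × ℝ in nhds (t, a), K₁ < p.2 - (T - p.1) :=
      Continuous.eventually_lt_nhds (by fun_prop) (by fun_prop) ha
    have e2 : ∀ᶠ p : ℝ × ℝ in nhds (t, a), p.2 + s * (T - p.1) < K₂ :=
      Continuous.eventually_lt_nhds (by fun_prop) (by fun_prop) hb
    have heq : (fun p : ℝ × ℝ => asianV T K₁ K₂ p.1 p.2 β γ) =ᶠ[nhds (t, a)]
        fun p => s * (T - p.1) + p.2 - K₁ := by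
      filter_upwards [hnear, e1, e2] with p ⟨hτp, hsp, hqp⟩ h1 h2
      simp only [asianV, ← hs, ← hq]
      rw [if_neg (by linarith), if_pos (by linarith)]
    refine differentiableAt_and_fderiv_apply_eq_of_eventuallyEq heq
      (by fun_prop) ?_
    refine HasDerivAt.congr_deriv
      (((hline_t.const_mul s).add hline_a).sub_const K₁) ?_
    ring
  · intro ha hb hc
    have e1 : ∀ᶠ p : ℝ × ℝ in nhds (t, a), p.2 - (T - p.1) < K₁ :=
      Continuous.eventually_lt_nhds (by fun_prop) (by fun_prop) ha
    have e2 : ∀ᶠ p : ℝ × ℝ in nhds (t, a), p.2 + s * (T - p.1) < K₂ :=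
      Continuous.eventually_lt_nhds (by fun_prop) (by fun_prop) hb
    have e3 : ∀ᶠ p : ℝ × ℝ in nhds (t, a), K₂ < p.2 + q * (T - p.1) :=
      Continuous.eventually_lt_nhds (by fun_prop) (by fun_prop) hc
    have hne : 1 + (K₂ - a) / (T - t) ≠ 0 := by
      rw [one_add_div hτ.ne']
      exact div_ne_zero (by linarith) hτ.ne'
    have heq : (fun p : ℝ × ℝ => asianV T K₁ K₂ p.1 p.2 β γ) =ᶠ[nhds (t, a)]
        fun p => (2 * γ + β) * (K₂ - K₁) / (1 + (K₂ - p.2) / (T - p.1)) := by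
      filter_upwards [hnear, e1, e2, e3] with p ⟨hτp, hsp, hqp⟩ h1 h2 h3
      simp only [asianV, ← hs, ← hq]
      rw [if_neg (by linarith), if_neg (by linarith), if_pos (by linarith)]
    refine differentiableAt_and_fderiv_apply_nonpos_of_eventuallyEq heq
      (by fun_prop (disch := first | exact hτ.ne' | exact hne)) ?_ ?_
    · have hden := ((hline_a.const_sub K₂).div hline_t (by simpa using hτ.ne')).const_add 1
      refine ((hasDerivAt_const (0 : ℝ) ((2 * γ + β) * (K₂ - K₁))).div hden
        (by simpa using hne)).congr_deriv ?_
      simp only [Pi.div_apply, zero_mul, add_zero]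
      field_simp
      ring
    · refine mul_nonpos_of_nonneg_of_nonpos (div_nonneg (mul_nonneg ?_ ?_) (sq_nonneg _)) ?_
      · linarith
      · linarith
      · have : -(K₂ - a) / (T - t) ^ 2 + s / (T - t) = (a + s * (T - t) - K₂) / (T - t) ^ 2 := by
          field_simp
          ring
        rw [this]
        exact div_nonpos_of_nonpos_of_nonneg (by linarith) (sq_nonneg _)
  · intro ha hb hc
    have e1 : ∀ᶠ p : ℝ × ℝ in nhds (t, a), p.2 - (T - p.1) < K₁ :=
      Continuous.eventually_lt_nhds (by fun_prop) (by fun_prop) ha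
    have e2 : ∀ᶠ p : ℝ × ℝ in nhds (t, a), K₁ < p.2 :=
      Continuous.eventually_lt_nhds (by fun_prop) (by fun_prop) hb
    have e3 : ∀ᶠ p : ℝ × ℝ in nhds (t, a), p.2 + q * (T - p.1) < K₂ :=
      Continuous.eventually_lt_nhds (by fun_prop) (by fun_prop) hc
    have heq : (fun p : ℝ × ℝ => asianV T K₁ K₂ p.1 p.2 β γ) =ᶠ[nhds (t, a)]
        fun p => γ * (T - p.1) - (γ + β) * (K₁ - p.2) := by
      filter_upwards [hnear, e1, e2, e3] with p ⟨hτp, hsp, hqp⟩ h1 h2 h3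
      simp only [asianV, ← hs, ← hq]
      rw [if_neg (by linarith), if_neg (by linarith), if_neg (by linarith),
        if_pos (by linarith)]
    refine differentiableAt_and_fderiv_apply_nonpos_of_eventuallyEq heq
      (by fun_prop) ?_ ?_
    · refine HasDerivAt.congr_deriv
        ((hline_t.const_mul γ).sub ((hline_a.const_sub K₁).const_mul (γ + β))) ?_
      ring
    · nlinarith
  · intro ha hb hc
    have e1 : ∀ᶠ p : ℝ × ℝ in nhds (t, a), p.2 < K₁ :=
      Continuous.eventually_lt_nhds (by fun_prop) (by fun_prop) ha
    have e2 : ∀ᶠ p : ℝ × ℝ in nhds (t, a), p.2 + q * (T - p.1) < K₂ :=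
      Continuous.eventually_lt_nhds (by fun_prop) (by fun_prop) hb
    have e3 : ∀ᶠ p : ℝ × ℝ in nhds (t, a), K₂ < p.2 + (T - p.1) :=
      Continuous.eventually_lt_nhds (by fun_prop) (by fun_prop) hc
    have hu : K₂ - a ≠ 0 := by
      have : 0 < K₂ - a := by linarith
      exact this.ne'
    have heq : (fun p : ℝ × ℝ => asianV T K₁ K₂ p.1 p.2 β γ) =ᶠ[nhds (t, a)]
        fun p => γ * (T - p.1) * (K₂ - K₁) / (K₂ - p.2) := by
      filter_upwards [hnear, e1, e2, e3] with p ⟨hτp, hsp, hqp⟩ h1 h2 h3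
      simp only [asianV, ← hs, ← hq]
      rw [if_neg (by linarith), if_neg (by linarith), if_neg (by linarith),
        if_neg (by linarith), if_pos (by linarith)]
    refine differentiableAt_and_fderiv_apply_nonpos_of_eventuallyEq heq
      (by fun_prop (disch := exact hu)) ?_ ?_
    · refine (((hline_t.const_mul γ).mul_const (K₂ - K₁)).div (hline_a.const_sub K₂)
        (by simpa using hu)).congr_deriv ?_
      simp only [zero_mul, add_zero]
      field_simp
      ring
    · have hsτ := mul_le_mul_of_nonneg_right hsq hτ.le
      refine mul_nonpos_of_nonpos_of_nonneg
        (div_nonpos_of_nonpos_of_nonneg ?_ (sq_nonneg _)) (by linarith)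
      exact mul_nonpos_of_nonpos_of_nonneg (by linarith) (by linarith)
  · intro ha hb hc
    have e1 : ∀ᶠ p : ℝ × ℝ in nhds (t, a), p.2 < K₁ :=
      Continuous.eventually_lt_nhds (by fun_prop) (by fun_prop) ha
    have e2 : ∀ᶠ p : ℝ × ℝ in nhds (t, a), K₁ < p.2 + (T - p.1) :=
      Continuous.eventually_lt_nhds (by fun_prop) (by fun_prop) hb
    have e3 : ∀ᶠ p : ℝ × ℝ in nhds (t, a), p.2 + (T - p.1) < K₂ :=
      Continuous.eventually_lt_nhds (by fun_prop) (by fun_prop) hc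
    have heq : (fun p : ℝ × ℝ => asianV T K₁ K₂ p.1 p.2 β γ) =ᶠ[nhds (t, a)]
        fun p => γ * (T - p.1 - (K₁ - p.2)) := by
      filter_upwards [hnear, e1, e2, e3] with p ⟨hτp, hsp, hqp⟩ h1 h2 h3
      simp only [asianV, ← hs, ← hq]
      rw [if_neg (by linarith), if_neg (by linarith), if_neg (by linarith),
        if_neg (by linarith), if_neg (by linarith), if_pos (by linarith)]
    refine differentiableAt_and_fderiv_apply_nonpos_of_eventuallyEq heq
      (by fun_prop) ?_ ?_
    · refine HasDerivAt.congr_deriv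
        ((hline_t.sub (hline_a.const_sub K₁)).const_mul γ) ?_
      ring
    · exact mul_nonpos_of_nonneg_of_nonpos (by linarith) (by linarith)
  · intro h
    have e1 : ∀ᶠ p : ℝ × ℝ in nhds (t, a), p.2 + (T - p.1) < K₁ :=
      Continuous.eventually_lt_nhds (by fun_prop) (by fun_prop) h
    have heq : (fun p : ℝ × ℝ => asianV T K₁ K₂ p.1 p.2 β γ) =ᶠ[nhds (t, a)]
        fun p => 0 := by
      filter_upwards [hnear, e1] with p ⟨hτp, hsp, hqp⟩ h1
      simp only [asianV, ← hs, ← hq]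
      rw [if_neg (by linarith), if_neg (by linarith), if_neg (by linarith),
        if_neg (by linarith), if_neg (by linarith), if_neg (by linarith)]
    refine differentiableAt_and_fderiv_apply_eq_of_eventuallyEq heq
      (by fun_prop) ?_
    exact hasDerivAt_const _ _
end
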